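/- Let α > 1 be such that σ := σ(α) is rational, written σ = p/q with p, q ∈ ℕ coprime, and assume 4 divides p and q is odd. Then there exists c > 0 such that for every ℓ ∈ ℕ₀ and k ∈ ℕ with ℓ ≠ σk − σ/4, either j_{ℓ,k}² − α²ℓ² = 0 or |j_{ℓ,k}² − α²ℓ²| ≥ c·j_{ℓ,k}; moreover the set { j_{ℓ,k}² − α²ℓ² : ℓ ∈ ℕ₀, k ∈ ℕ, ℓ ≠ σk − σ/4 } is unbounded from above and below and has no finite accumulation points in ℝ. -/

import Mathlib

open Real Set Filter

/-- The Bessel function of the first kind,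
`J_ν(x) = Σ_{n=0}^∞ ((−1)ⁿ/(n!·Γ(n+ν+1)))·(x/2)^{2n+ν}`. -/
noncomputable def besselJ (ν x : ℝ) : ℝ :=
  ∑' n : ℕ, ((-1 : ℝ)^n / ((n.factorial : ℝ) * Real.Gamma ((n : ℝ) + ν + 1)))
    * (x/2) ^ (2*(n:ℝ) + ν)

/-- The function `y ↦ π/(√(y²−1) − arccos(1/y))`, a strictly decreasing bijection
from `(1,∞)` onto `(0,∞)`. -/
noncomputable def sigmaF (y : ℝ) : ℝ :=
  Real.pi / (Real.sqrt (y^2 - 1) - Real.arccos (1/y))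

section
open Real Set Filter

/-- coefficient of the reduced Bessel series -/
noncomputable def phiC (n m : ℕ) : ℝ := (-1 : ℝ)^m / ((m.factorial : ℝ) * ((m+n).factorial : ℝ))

noncomputable def phiB (n : ℕ) (y : ℝ) : ℝ := ∑' m : ℕ, phiC n m * y^m

noncomputable def jb (n : ℕ) (x : ℝ) : ℝ := (x/2)^n * phiB n (x^2/4)

lemma abs_phiC_le (n m : ℕ) : |phiC n m| ≤ 1 / (m.factorial : ℝ) := by
  unfold phiC
  rw [abs_div, abs_pow, abs_neg, abs_one, one_pow, abs_of_pos (by positivity)]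
  apply one_div_le_one_div_of_le (by positivity)
  have h1 : (1:ℝ) ≤ ((m+n).factorial : ℝ) := by exact_mod_cast Nat.one_le_iff_ne_zero.mpr (Nat.factorial_ne_zero _)
  have h2 : (0:ℝ) < (m.factorial : ℝ) := by positivity
  nlinarith

lemma summable_phiB (n : ℕ) (y : ℝ) : Summable (fun m => phiC n m * y^m) := by
  refine Summable.of_norm_bounded (Real.summable_pow_div_factorial |y|) (fun m => ?_)
  rw [Real.norm_eq_abs, abs_mul, abs_pow]
  calc |phiC n m| * |y|^m ≤ 1 / (m.factorial : ℝ) * |y|^m := by gcongr; exact abs_phiC_le n m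
    _ = _ := by ring

lemma phiC_succ (n m : ℕ) : phiC n (m+1) * ((m:ℝ)+1) = - phiC (n+1) m := by
  unfold phiC
  rw [show m + 1 + n = m + (n+1) by ring, Nat.factorial_succ m]
  push_cast
  field_simp
  ring

lemma hasDerivAt_phiB (n : ℕ) (y : ℝ) : HasDerivAt (phiB n) (- phiB (n+1) y) y := by
  have hu : Summable (fun m : ℕ => (|y|+1)^(m-1) / ((m-1).factorial : ℝ)) := by
    rw [← summable_nat_add_iff 1]
    simpa using Real.summable_pow_div_factorial (|y|+1)
  have key := hasDerivAt_tsum_of_isPreconnected (u := fun m : ℕ => (|y|+1)^(m-1) / ((m-1).factorial : ℝ))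
    (g := fun m z => phiC n m * z^m) (g' := fun m z => phiC n m * (m * z^(m-1)))
    (t := Metric.ball 0 (|y|+1)) (y₀ := y) (y := y) hu Metric.isOpen_ball
    (convex_ball _ _).isPreconnected ?_ ?_ ?_ (summable_phiB n y) ?_
  · refine HasDerivAt.congr_deriv key ?_
    symm
    rw [← Summable.sum_add_tsum_nat_add 1]
    · simp only [Finset.range_one, Finset.sum_singleton, Nat.cast_zero, zero_mul, mul_zero, zero_add]
      unfold phiB
      rw [← tsum_neg]
      congr 1; ext m
      push_cast
      rw [← mul_assoc, phiC_succ]; simp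
    · rw [← summable_nat_add_iff 1]
      refine (summable_phiB (n+1) y).neg.congr (fun m => ?_)
      push_cast
      rw [← mul_assoc, phiC_succ]; simp
  · intro m z _
    exact (hasDerivAt_pow m z).const_mul _
  · intro m z hz
    have hz' : |z| ≤ |y| + 1 := by
      have : ‖z‖ < |y|+1 := by simpa using hz
      exact this.le
    rw [Real.norm_eq_abs, abs_mul, abs_mul, abs_pow]
    rcases m with _ | m
    · simp
    · have h := abs_phiC_le n (m+1)
      rw [Nat.factorial_succ] at h
      simp only [Nat.add_sub_cancel, Nat.abs_cast]
      calc |phiC n (m+1)| * (((m+1:ℕ):ℝ) * |z|^m) 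
          ≤ 1 / (((m+1) * m.factorial : ℕ) : ℝ) * (((m+1:ℕ):ℝ) * (|y|+1)^m) := by gcongr
        _ = _ := by push_cast; field_simp
  · simp
  · simp

lemma phiB_rec (n : ℕ) (y : ℝ) : (n+1) * phiB (n+1) y - y * phiB (n+2) y = phiB n y := by
  unfold phiB
  have h0 := (summable_phiB n y)
  have h1 := (summable_phiB (n+1) y)
  have h2 := (summable_phiB (n+2) y)
  rw [h0.tsum_eq_zero_add, h1.tsum_eq_zero_add, ← tsum_mul_left, mul_add, ← tsum_mul_left]
  have h1' := ((summable_nat_add_iff 1).2 h1).mul_left ((n:ℝ)+1)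
  rw [add_sub_assoc, ← Summable.tsum_sub h1' (h2.mul_left y)]
  congr 1
  · unfold phiC
    simp [Nat.factorial_succ]; field_simp
  · congr 1; ext m
    unfold phiC
    rw [show m + 1 + (n+1) = (m+1+n)+1 by ring, show m + (n+2) = (m+1+n)+1 by ring, Nat.factorial_succ (m+1+n),
      Nat.factorial_succ m]
    push_cast
    field_simp
    ring

lemma phiB_pos_of_lt (n : ℕ) (y : ℝ) (hy0 : 0 ≤ y) (hy : 2 * y ≤ n + 1) : 0 < phiB n y := by
  have hb : ∀ m : ℕ, |phiC n (m+1) * y^(m+1)| ≤ 1 / (n.factorial:ℝ) * (1/2) * (1/2)^m * (1 / ((m+1).factorial:ℝ)) := by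
    intro m
    have h1 : ((n.factorial : ℝ) * ((n+1:ℕ):ℝ)^(m+1)) ≤ ((m+1+n).factorial : ℝ) := by
      have := Nat.factorial_mul_pow_le_factorial (m := n) (n := m+1)
      rw [add_comm n (m+1)] at this
      exact_mod_cast this
    unfold phiC
    rw [abs_mul, abs_div, abs_pow, abs_neg, abs_one, one_pow, abs_of_pos (by positivity), abs_of_nonneg (by positivity)]
    have h2 : y^(m+1) ≤ ((n+1)/2:ℝ)^(m+1) := by gcongr; linarith
    calc 1 / (((m+1).factorial:ℝ) * ((m+1+n).factorial:ℝ)) * y^(m+1) 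
        ≤ 1 / (((m+1).factorial:ℝ) * ((n.factorial : ℝ) * ((n+1:ℕ):ℝ)^(m+1))) * ((n+1)/2:ℝ)^(m+1) := by gcongr
      _ = _ := by
        push_cast; rw [div_pow, one_div_pow]; field_simp; ring
  have hs : Summable (fun m : ℕ => 1 / (n.factorial:ℝ) * (1/2) * (1/2)^m) :=
    summable_geometric_two.mul_left _
  have hts : ∑' m : ℕ, 1 / (n.factorial:ℝ) * (1/2) * (1/2:ℝ)^m = 1 / (n.factorial:ℝ) := by
    rw [tsum_mul_left, tsum_geometric_two]; ring
  have h0 := summable_phiB n y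
  unfold phiB
  rw [h0.tsum_eq_zero_add]
  have h1 := (summable_nat_add_iff 1).2 h0
  have hle : ∀ m : ℕ, -(1 / (n.factorial:ℝ) * (1/2) * (1/2)^m) ≤ phiC n (m+1) * y^(m+1) := by
    intro m
    refine (abs_le.1 ((hb m).trans ?_)).1
    have : 1 / ((m+1).factorial:ℝ) ≤ 1 := by
      rw [div_le_one (by positivity)]
      exact_mod_cast Nat.one_le_iff_ne_zero.mpr (Nat.factorial_ne_zero _)
    exact mul_le_of_le_one_right (by positivity) this
  have hlt : -(1 / (n.factorial:ℝ) * (1/2) * (1/2)^1) < phiC n (1+1) * y^(1+1) := by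
    refine (abs_lt.1 ((hb 1).trans_lt ?_)).1
    have : (0:ℝ) < 1 / (n.factorial:ℝ) * (1/2) * (1/2)^1 := by positivity
    norm_num; field_simp; norm_num
  have := hs.neg.tsum_lt_tsum hle hlt h1
  rw [tsum_neg, hts] at this
  have e : phiC n 0 * y^0 = 1 / (n.factorial:ℝ) := by simp [phiC]
  rw [e]; linarith

lemma phiB_ne (n : ℕ) (y : ℝ) (hy : 0 < y) (h0 : phiB n y = 0) (h1 : phiB (n+1) y = 0) : False := by
  have key : ∀ m : ℕ, phiB (n+m) y = 0 ∧ phiB (n+m+1) y = 0 := by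
    intro m
    induction m with
    | zero => exact ⟨h0, h1⟩
    | succ m ih =>
      refine ⟨ih.2, ?_⟩
      have := phiB_rec (n+m) y
      rw [ih.1, ih.2] at this
      have h : y * phiB (n+m+2) y = 0 := by linarith
      exact (mul_eq_zero.1 h).resolve_left hy.ne'
  obtain ⟨m, hm⟩ := exists_nat_ge (2*y)
  have := phiB_pos_of_lt (n+m) y hy.le (by push_cast; linarith [(Nat.cast_nonneg n : (0:ℝ) ≤ n)])
  exact this.ne' (key m).1

lemma besselJ_eq_jb (n : ℕ) (x : ℝ) : besselJ n x = jb n x := by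
  unfold besselJ jb phiB
  rw [← tsum_mul_left]
  congr 1; ext m
  rw [show (m:ℝ) + n + 1 = ((m+n:ℕ):ℝ) + 1 by push_cast; ring, Real.Gamma_nat_eq_factorial,
    show 2 * (m:ℝ) + n = ((2*m+n:ℕ):ℝ) by push_cast; ring, Real.rpow_natCast, pow_add, pow_mul]
  unfold phiC
  rw [show (x/2)^2 = x^2/4 by ring]
  ring

lemma jb_eq_zero_iff (n : ℕ) {x : ℝ} (hx : 0 < x) : jb n x = 0 ↔ phiB n (x^2/4) = 0 := by
  unfold jb
  rw [mul_eq_zero]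
  constructor
  · rintro (h | h)
    · exact absurd h (by positivity)
    · exact h
  · exact Or.inr

lemma jb_ne (n : ℕ) {x : ℝ} (hx : 0 < x) (h0 : jb n x = 0) (h1 : jb (n+1) x = 0) : False :=
  phiB_ne n (x^2/4) (by positivity) ((jb_eq_zero_iff n hx).1 h0) ((jb_eq_zero_iff (n+1) hx).1 h1)

lemma hasDerivAt_phiB_sq (n : ℕ) (x : ℝ) :
    HasDerivAt (fun x => phiB n (x^2/4)) (-(x/2) * phiB (n+1) (x^2/4)) x := by
  have h1 : HasDerivAt (fun x : ℝ => x^2/4) (x/2) x := by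
    have := (hasDerivAt_pow 2 x).div_const 4
    exact this.congr_deriv (by norm_num; ring)
  have := (hasDerivAt_phiB n (x^2/4)).comp x h1
  exact this.congr_deriv (by ring)

lemma hasDerivAt_jb (n : ℕ) {x : ℝ} (hx : 0 < x) :
    HasDerivAt (jb n) (n / x * jb n x - jb (n+1) x) x := by
  have h1 : HasDerivAt (fun x : ℝ => (x/2)^n) (n / x * (x/2)^n) x := by
    have := ((hasDerivAt_id x).div_const 2).pow n
    refine HasDerivAt.congr_deriv this ?_
    rcases n with _ | n
    · simp
    · simp only [Nat.add_sub_cancel, pow_succ, id]; field_simp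
  have := h1.mul (hasDerivAt_phiB_sq n x)
  refine HasDerivAt.congr_deriv this ?_
  unfold jb; rw [pow_succ]; ring

lemma hasDerivAt_jb_succ (n : ℕ) {x : ℝ} (hx : 0 < x) :
    HasDerivAt (jb (n+1)) (jb n x - (n+1) / x * jb (n+1) x) x := by
  refine (hasDerivAt_jb (n+1) hx).congr_deriv ?_
  have h := phiB_rec n (x^2/4)
  unfold jb
  rw [← h]
  push_cast
  rw [pow_succ, pow_succ]
  field_simp
  ring

/-- Rolle: between consecutive zeros of `J_n` there is a zero of `J_{n+1}`. -/
lemma rolle_up (n : ℕ) {a b : ℝ} (ha : 0 < a) (hab : a < b) (h1 : jb n a = 0) (h2 : jb n b = 0) :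
    ∃ c, a < c ∧ c < b ∧ jb (n+1) c = 0 := by
  have hb := ha.trans hab
  obtain ⟨c, hc, h⟩ := exists_hasDerivAt_eq_zero (f := fun x => phiB n (x^2/4))
    (f' := fun x => -(x/2) * phiB (n+1) (x^2/4)) hab
    (fun x _ => (hasDerivAt_phiB_sq n x).continuousAt.continuousWithinAt)
    (by beta_reduce; rw [(jb_eq_zero_iff n ha).1 h1, (jb_eq_zero_iff n hb).1 h2])
    (fun x _ => hasDerivAt_phiB_sq n x)
  have hc0 : 0 < c := ha.trans hc.1
  refine ⟨c, hc.1, hc.2, (jb_eq_zero_iff (n+1) hc0).2 ?_⟩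
  refine (mul_eq_zero.1 h).resolve_left ?_
  simp [hc0.ne']

lemma rolle_down (n : ℕ) {a b : ℝ} (ha : 0 ≤ a) (hab : a < b) (h1 : a = 0 ∨ jb (n+1) a = 0) (h2 : jb (n+1) b = 0) :
    ∃ c, a < c ∧ c < b ∧ jb n c = 0 := by
  have hb := ha.trans_lt hab
  have hd : ∀ x : ℝ, HasDerivAt (fun x => x^(2*(n+1)) * phiB (n+1) (x^2/4)) (2 * x^(2*n+1) * phiB n (x^2/4)) x := by
    intro x
    have := (hasDerivAt_pow (2*(n+1)) x).mul (hasDerivAt_phiB_sq (n+1) x)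
    refine HasDerivAt.congr_deriv this ?_
    rw [← phiB_rec n]
    rw [show 2*(n+1)-1 = 2*n+1 by omega, show 2*(n+1) = 2*n+1+1 by ring, pow_succ x (2*n+1)]
    push_cast; ring
  obtain ⟨c, hc, h⟩ := exists_hasDerivAt_eq_zero (f := fun x => x^(2*(n+1)) * phiB (n+1) (x^2/4)) hab
    (fun x _ => (hd x).continuousAt.continuousWithinAt)
    (by
      beta_reduce; rw [(jb_eq_zero_iff (n+1) hb).1 h2]
      rcases h1 with h1 | h1
      · simp [h1]
      · rcases ha.eq_or_lt with h | h
        · simp [← h]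
        · rw [(jb_eq_zero_iff (n+1) h).1 h1]; simp)
    (fun x _ => hd x)
  have hc0 : 0 < c := ha.trans_lt hc.1
  refine ⟨c, hc.1, hc.2, (jb_eq_zero_iff n hc0).2 ?_⟩
  refine (mul_eq_zero.1 h).resolve_left ?_
  positivity
end

section
open Real Set Filter Topology

noncomputable def sB (n : ℕ) (x : ℝ) : ℝ := √(x^2 - (n:ℝ)^2)
noncomputable def gB (n : ℕ) (x : ℝ) : ℝ := sB n x - n * Real.arccos (n / x)
noncomputable def rhoB (n : ℕ) (x : ℝ) : ℝ := (x^3/4 + x * (n:ℝ)^2) / (sB n x)^5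
noncomputable def vB (n : ℕ) (x : ℝ) : ℝ := sB n x * jb n x
noncomputable def wB (n : ℕ) (x : ℝ) : ℝ :=
  n * jb n x - x * jb (n+1) x + x^2 / (2 * (sB n x)^2) * jb n x
noncomputable def zB (n : ℕ) (x : ℝ) : ℂ := (wB n x : ℂ) + (vB n x : ℂ) * Complex.I

lemma sB_arg_pos {n : ℕ} {x : ℝ} (hx : (n:ℝ) < x) : 0 < x^2 - (n:ℝ)^2 := by
  have : (0:ℝ) ≤ n := Nat.cast_nonneg n
  nlinarith

lemma sB_pos {n : ℕ} {x : ℝ} (hx : (n:ℝ) < x) : 0 < sB n x := Real.sqrt_pos.2 (sB_arg_pos hx)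

lemma sB_sq {n : ℕ} {x : ℝ} (hx : (n:ℝ) < x) : (sB n x)^2 = x^2 - (n:ℝ)^2 :=
  Real.sq_sqrt (sB_arg_pos hx).le

lemma pos_of_nlt {n : ℕ} {x : ℝ} (hx : (n:ℝ) < x) : 0 < x := (Nat.cast_nonneg n).trans_lt hx

lemma hasDerivAt_sB {n : ℕ} {x : ℝ} (hx : (n:ℝ) < x) : HasDerivAt (sB n) (x / sB n x) x := by
  have h1 : HasDerivAt (fun x : ℝ => x^2 - (n:ℝ)^2) (2*x) x := by
    have := (hasDerivAt_pow 2 x).sub_const ((n:ℝ)^2)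
    exact this.congr_deriv (by norm_num)
  refine (h1.sqrt (sB_arg_pos hx).ne').congr_deriv ?_
  unfold sB
  rw [mul_div_mul_left _ _ two_ne_zero]

lemma hasDerivAt_gB {n : ℕ} {x : ℝ} (hx : (n:ℝ) < x) : HasDerivAt (gB n) (sB n x / x) x := by
  have hx0 := pos_of_nlt hx
  have hs := sB_pos hx
  have hs2 := sB_sq hx
  have h1 : HasDerivAt (fun x : ℝ => (n:ℝ) / x) (-(n:ℝ) / x^2) x := by
    have := (hasDerivAt_inv hx0.ne').const_mul (n:ℝ)
    simpa [div_eq_mul_inv] using this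
  have hlt : (n:ℝ)/x < 1 := by rw [div_lt_one hx0]; exact hx
  have hge : 0 ≤ (n:ℝ)/x := by positivity
  have h2 := (Real.hasDerivAt_arccos (x := (n:ℝ)/x) (by linarith) hlt.ne).comp x h1
  have h3 := (hasDerivAt_sB hx).sub (h2.const_mul (n:ℝ))
  refine h3.congr_deriv ?_
  have hsq : √(1 - ((n:ℝ)/x)^2) = sB n x / x := by
    rw [show 1 - ((n:ℝ)/x)^2 = (sB n x / x)^2 by rw [div_pow, div_pow, hs2]; field_simp]
    exact Real.sqrt_sq (by positivity)
  rw [hsq]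
  field_simp
  rw [hs2]

lemma hasDerivAt_vB {n : ℕ} {x : ℝ} (hx : (n:ℝ) < x) :
    HasDerivAt (vB n) (sB n x / x * wB n x + x / (2 * (sB n x)^2) * vB n x) x := by
  have hx0 := pos_of_nlt hx
  have hs := sB_pos hx
  refine ((hasDerivAt_sB hx).mul (hasDerivAt_jb n hx0)).congr_deriv ?_
  unfold vB wB
  field_simp
  ring

lemma hasDerivAt_wB {n : ℕ} {x : ℝ} (hx : (n:ℝ) < x) :
    HasDerivAt (wB n) (-(sB n x / x) * vB n x - rhoB n x * vB n x
      + x / (2 * (sB n x)^2) * wB n x) x := by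
  have hx0 := pos_of_nlt hx
  have hs := sB_pos hx
  have hs2 := sB_sq hx
  have h1 := (hasDerivAt_jb n hx0).const_mul (n:ℝ)
  have h2 := (hasDerivAt_id x).mul (hasDerivAt_jb_succ n hx0)
  have h3 : HasDerivAt (fun x => x^2 / (2 * (sB n x)^2)) (x / (sB n x)^2 - x^3 / (sB n x)^4) x := by
    have := (hasDerivAt_pow 2 x).div (((hasDerivAt_sB hx).pow 2).const_mul 2) (by simp only [Pi.pow_apply]; positivity)
    refine this.congr_deriv ?_
    simp only [Pi.pow_apply]
    push_cast
    field_simp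
  have h4 := (h1.sub h2).add (h3.mul (hasDerivAt_jb n hx0))
  refine h4.congr_deriv ?_
  unfold vB wB rhoB
  simp only [id]
  have hn : (n:ℝ)^2 = x^2 - (sB n x)^2 := by linarith
  have key : ∀ (N s a b : ℝ), 0 < s → N^2 = x^2 - s^2 → N * (N / x * a - b) - (1 * b + x * (a - (N + 1) / x * b)) +
    ((x / s ^ 2 - x ^ 3 / s ^ 4) * a + x ^ 2 / (2 * s ^ 2) * (N / x * a - b)) =
  -(s / x) * (s * a) - (x ^ 3 / 4 + x * N ^ 2) / s ^ 5 * (s * a) +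
    x / (2 * s ^ 2) * (N * a - x * b + x ^ 2 / (2 * s ^ 2) * a) := by
    intro N s a b hs hN
    have e1 : N * (N / x * a - b) = N^2 / x * a - N * b := by ring
    rw [e1, hN]
    field_simp
    ring
  exact key n (sB n x) _ _ hs hn

lemma zB_ne {n : ℕ} {x : ℝ} (hx : (n:ℝ) < x) : zB n x ≠ 0 := by
  intro h
  have hx0 := pos_of_nlt hx
  have hre : wB n x = 0 := by simpa [zB] using congrArg Complex.re h
  have him : vB n x = 0 := by simpa [zB] using congrArg Complex.im h
  have hj : jb n x = 0 := (mul_eq_zero.1 him).resolve_left (sB_pos hx).ne'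
  unfold wB at hre
  rw [hj] at hre
  have : x * jb (n+1) x = 0 := by linarith
  exact jb_ne n hx0 hj ((mul_eq_zero.1 this).resolve_left hx0.ne')

lemma hasDerivAt_zB {n : ℕ} {x : ℝ} (hx : (n:ℝ) < x) :
    HasDerivAt (zB n) (((sB n x / x : ℝ) * Complex.I + (x / (2 * (sB n x)^2) : ℝ)) * zB n x
      - (rhoB n x * vB n x : ℝ)) x := by
  have h := (hasDerivAt_wB hx).ofReal_comp.add ((hasDerivAt_vB hx).ofReal_comp.mul_const Complex.I)
  refine HasDerivAt.congr_deriv h ?_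
  unfold zB
  push_cast
  linear_combination (-(sB n x / x : ℂ) * vB n x) * Complex.I_sq

lemma rhoB_nonneg {n : ℕ} {x : ℝ} (hx : (n:ℝ) < x) : 0 ≤ rhoB n x := by
  have := pos_of_nlt hx
  have := sB_pos hx
  unfold rhoB; positivity

lemma rhoB_cont {n : ℕ} {x : ℝ} (hx : (n:ℝ) < x) : ContinuousAt (rhoB n) x := by
  have h := (hasDerivAt_sB hx).continuousAt
  unfold rhoB
  have := (sB_pos hx).ne'
  fun_prop (disch := positivity)

lemma phase_exists (n : ℕ) : ∃ Λ : ℝ → ℂ, ∀ x : ℝ, (n:ℝ) < x →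
    HasDerivAt Λ (-(rhoB n x * vB n x : ℝ) / zB n x) x ∧
    zB n x = (√(sB n x) : ℝ) * Complex.exp (Λ x + gB n x * Complex.I) := by
  set F : ℝ → ℂ := fun x => -(rhoB n x * vB n x : ℝ) / zB n x with hF
  have hFc : ∀ x : ℝ, (n:ℝ) < x → ContinuousAt F x := by
    intro x hx
    have h1 := (hasDerivAt_zB hx).continuousAt
    have h2 := (hasDerivAt_vB hx).continuousAt
    have h3 := rhoB_cont hx
    have h4 : ContinuousAt (fun x => (rhoB n x * vB n x : ℝ)) x := h3.mul h2
    have h5 : ContinuousAt (fun x => ((rhoB n x * vB n x : ℝ) : ℂ)) x :=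
      Complex.continuous_ofReal.continuousAt.comp h4
    exact h5.neg.div h1 (zB_ne hx)
  set x0 : ℝ := n + 1 with hx0
  have hx0' : (n:ℝ) < x0 := by linarith
  have hE : ∀ x : ℝ, (n:ℝ) < x → HasDerivAt (fun x => ∫ t in x0..x, F t) (F x) x := by
    intro x hx
    have hsub : uIcc x0 x ⊆ Ioi (n:ℝ) := by
      intro t ht
      exact lt_of_lt_of_le (lt_min hx0' hx) ht.1
    have hcon : ContinuousOn F (Ioi (n:ℝ)) := fun t ht => (hFc t ht).continuousWithinAt
    refine intervalIntegral.integral_hasDerivAt_right ((hcon.mono hsub).intervalIntegrable) ?_ (hFc x hx)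
    exact hcon.stronglyMeasurableAtFilter isOpen_Ioi x hx
  have hc0 : zB n x0 / ((√(sB n x0) : ℝ) * Complex.exp (gB n x0 * Complex.I)) ≠ 0 := by
    refine div_ne_zero (zB_ne hx0') (mul_ne_zero ?_ (Complex.exp_ne_zero _))
    exact_mod_cast (Real.sqrt_pos.2 (sB_pos hx0')).ne'
  set c : ℂ := Complex.log (zB n x0 / ((√(sB n x0) : ℝ) * Complex.exp (gB n x0 * Complex.I))) with hc
  refine ⟨fun x => c + ∫ t in x0..x, F t, fun x hx => ⟨(hE x hx).const_add c, ?_⟩⟩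
  set G : ℝ → ℂ := fun x => zB n x * Complex.exp (-((c + ∫ t in x0..x, F t) + gB n x * Complex.I + ((1/2 * Real.log (sB n x) : ℝ) : ℂ))) with hG
  have hGd : ∀ x ∈ Ioi (n:ℝ), HasDerivAt G 0 x := by
    intro x hx
    have hx : (n:ℝ) < x := hx
    have h1 := (hasDerivAt_gB hx).ofReal_comp.mul_const Complex.I
    have h2 := (((hasDerivAt_sB hx).log (sB_pos hx).ne').const_mul (1/2:ℝ)).ofReal_comp
    have h3 := ((((hE x hx).const_add c).add h1).add h2).neg.cexp
    have h4 := (hasDerivAt_zB hx).mul h3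
    refine HasDerivAt.congr_deriv h4 ?_
    have hz := zB_ne hx
    have hs : (sB n x : ℂ) ≠ 0 := by exact_mod_cast (sB_pos hx).ne'
    have hxx : (x:ℂ) ≠ 0 := by exact_mod_cast (pos_of_nlt hx).ne'
    simp only [Pi.add_apply, Pi.neg_apply, hF]
    push_cast
    field_simp
    ring
  have hconst : G x = G x0 := by
    have := (convex_Ioi (n:ℝ)).is_const_of_fderivWithin_eq_zero (𝕜 := ℝ) (f := G)
      (fun y hy => (hGd y hy).differentiableAt.differentiableWithinAt) ?_ hx hx0'
    · exact this
    · intro y hy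
      have := (hGd y hy).hasFDerivAt.hasFDerivWithinAt (s := Ioi (n:ℝ)) |>.fderivWithin (isOpen_Ioi.uniqueDiffWithinAt hy)
      rw [this]; ext; simp
  have hexpl : ∀ y : ℝ, (n:ℝ) < y → Complex.exp ((1/2 * Real.log (sB n y) : ℝ) : ℂ) = (√(sB n y) : ℝ) := by
    intro y hy
    rw [← Complex.ofReal_exp, Real.sqrt_eq_rpow, Real.rpow_def_of_pos (sB_pos hy), mul_comm]
  have hG0 : G x0 = 1 := by
    simp only [hG, intervalIntegral.integral_same, add_zero]
    rw [Complex.exp_neg, Complex.exp_add, Complex.exp_add, hexpl x0 hx0', hc, Complex.exp_log hc0]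
    have := zB_ne hx0'
    have h2 : ((√(sB n x0) : ℝ) : ℂ) ≠ 0 := by
      exact_mod_cast (Real.sqrt_pos.2 (sB_pos hx0')).ne'
    have h3 := Complex.exp_ne_zero (gB n x0 * Complex.I)
    field_simp
  rw [hG0] at hconst
  simp only [hG] at hconst
  rw [Complex.exp_neg, Complex.exp_add, hexpl x hx, ← div_eq_mul_inv, div_eq_one_iff_eq] at hconst
  · rw [hconst]; ring
  · refine mul_ne_zero (Complex.exp_ne_zero _) ?_
    exact_mod_cast (Real.sqrt_pos.2 (sB_pos hx)).ne'
end

section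
open Real Set Filter Topology

lemma exists_lim_of_deriv_bound {E : Type*} [NormedAddCommGroup E] [NormedSpace ℝ E] [CompleteSpace E]
    {f f' : ℝ → E} {a K : ℝ} (ha : 0 < a) (hd : ∀ x ∈ Ioi a, HasDerivAt f (f' x) x)
    (hc : ContinuousOn f' (Ioi a)) (hb : ∀ x ∈ Ioi a, ‖f' x‖ ≤ K / x^2) :
    ∃ L, Tendsto f atTop (𝓝 L) := by
  refine ⟨_, MeasureTheory.tendsto_limUnder_of_hasDerivAt_of_integrableOn_Ioi (a := a) hd ?_⟩
  have h1 : MeasureTheory.IntegrableOn (fun x : ℝ => K * x^(-2:ℝ)) (Ioi a) :=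
    (integrableOn_Ioi_rpow_of_lt (by norm_num) ha).const_mul K
  refine MeasureTheory.Integrable.mono' h1 (hc.aestronglyMeasurable measurableSet_Ioi) ?_
  refine (MeasureTheory.ae_restrict_iff' measurableSet_Ioi).2 (Eventually.of_forall fun x hx => ?_)
  refine (hb x hx).trans (le_of_eq ?_)
  rw [Real.rpow_neg (ha.trans hx).le, div_eq_mul_inv]
  norm_cast

structure Ph (n : ℕ) (h : ℝ → ℝ) : Prop where
  d : ∀ x : ℝ, (n:ℝ) < x → HasDerivAt h (rhoB n x * (sin (gB n x + h x))^2) x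
  rel : ∀ x : ℝ, (n:ℝ) < x → vB n x * cos (gB n x + h x) = wB n x * sin (gB n x + h x)

structure PhC (n : ℕ) (Λ : ℝ → ℂ) : Prop where
  d : ∀ x : ℝ, (n:ℝ) < x → HasDerivAt Λ (-(rhoB n x * vB n x : ℝ) / zB n x) x
  z : ∀ x : ℝ, (n:ℝ) < x → zB n x = (√(sB n x) : ℝ) * Complex.exp (Λ x + gB n x * Complex.I)

lemma PhC.vw {n : ℕ} {Λ : ℝ → ℂ} (H : PhC n Λ) {x : ℝ} (hx : (n:ℝ) < x) :
    vB n x = √(sB n x) * exp (Λ x).re * sin (gB n x + (Λ x).im) ∧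
    wB n x = √(sB n x) * exp (Λ x).re * cos (gB n x + (Λ x).im) := by
  have h := H.z x hx
  constructor
  · have := congrArg Complex.im h
    simp only [zB, Complex.im_ofReal_mul, Complex.exp_im] at this
    simp at this
    rw [this, add_comm (gB n x)]; ring
  · have := congrArg Complex.re h
    simp only [zB, Complex.re_ofReal_mul, Complex.exp_re] at this
    simp at this
    rw [this, add_comm (gB n x)]; ring

lemma vz_norm (n : ℕ) (x : ℝ) : |vB n x| ≤ ‖zB n x‖ := by
  have := Complex.abs_im_le_norm (zB n x)
  simpa [zB] using this

lemma PhC.deriv_norm_le {n : ℕ} {x : ℝ} (hx : (n:ℝ) < x) :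
    ‖(-(rhoB n x * vB n x : ℝ) / zB n x : ℂ)‖ ≤ rhoB n x := by
  have hz : 0 < ‖zB n x‖ := norm_pos_iff.2 (zB_ne hx)
  rw [norm_div, norm_neg, Complex.norm_real, Real.norm_eq_abs, abs_mul, abs_of_nonneg (rhoB_nonneg hx),
    div_le_iff₀ hz]
  exact mul_le_mul_of_nonneg_left (vz_norm n x) (rhoB_nonneg hx)

lemma PhC.toPh {n : ℕ} {Λ : ℝ → ℂ} (H : PhC n Λ) (m : ℤ) : Ph n (fun x => (Λ x).im + m * π) := by
  constructor
  · intro x hx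
    obtain ⟨hv, hw⟩ := H.vw hx
    have hr : 0 < √(sB n x) * exp (Λ x).re :=
      mul_pos (Real.sqrt_pos.2 (sB_pos hx)) (exp_pos _)
    set r := √(sB n x) * exp (Λ x).re
    have h1 : HasDerivAt (fun x => (Λ x).im) ((-(rhoB n x * vB n x : ℝ) / zB n x : ℂ)).im x := by
      exact (Complex.imCLM.hasFDerivAt.comp_hasDerivAt x (H.d x hx))
    refine (h1.add_const (m*π)).congr_deriv ?_
    rw [← add_assoc, Real.sin_add_int_mul_pi]
    rw [Complex.div_im]
    have hn : Complex.normSq (zB n x) = r^2 := by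
      rw [Complex.normSq_apply]
      simp only [zB, Complex.add_re, Complex.ofReal_re, Complex.mul_re, Complex.I_re, Complex.ofReal_im,
        Complex.I_im, Complex.add_im, Complex.mul_im]
      rw [hv, hw]
      linear_combination r^2 * (Real.sin_sq_add_cos_sq (gB n x + (Λ x).im))
    rw [hn]
    simp only [zB, Complex.add_re, Complex.ofReal_re, Complex.mul_re, Complex.I_re, Complex.ofReal_im,
        Complex.I_im, Complex.add_im, Complex.mul_im, Complex.neg_re, Complex.neg_im]
    rw [hv, mul_pow ((-1:ℝ)^m), ← zpow_natCast ((-1:ℝ)^m), ← zpow_mul, mul_comm m, zpow_mul]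
    field_simp
    norm_num
    ring
  · intro x hx
    obtain ⟨hv, hw⟩ := H.vw hx
    rw [← add_assoc, Real.sin_add_int_mul_pi, Real.cos_add_int_mul_pi, hv, hw]
    ring

namespace Ph
variable {n : ℕ} {h : ℝ → ℝ}

lemma zero_iff (H : Ph n h) {x : ℝ} (hx : (n:ℝ) < x) : jb n x = 0 ↔ sin (gB n x + h x) = 0 := by
  have hr := H.rel x hx
  have hv : vB n x = 0 ↔ jb n x = 0 := by
    unfold vB; simp [(sB_pos hx).ne']
  rw [← hv]
  constructor
  · intro h0
    rw [h0, zero_mul] at hr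
    rcases mul_eq_zero.1 hr.symm with h1 | h1
    · exact absurd (by simp [zB, h0, h1] : zB n x = 0) (zB_ne hx)
    · exact h1
  · intro h0
    rw [h0, mul_zero] at hr
    refine (mul_eq_zero.1 hr).resolve_right fun hc => ?_
    have := Real.sin_sq_add_cos_sq (gB n x + h x)
    rw [h0, hc] at this; norm_num at this

lemma dth (H : Ph n h) {x : ℝ} (hx : (n:ℝ) < x) : HasDerivAt (fun x => gB n x + h x)
    (sB n x / x + rhoB n x * (sin (gB n x + h x))^2) x := (hasDerivAt_gB hx).add (H.d x hx)

lemma contOn (H : Ph n h) : ContinuousOn (fun x => gB n x + h x) (Ioi (n:ℝ)) :=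
  fun _ hx => (H.dth hx).continuousAt.continuousWithinAt

lemma strictMono (H : Ph n h) : StrictMonoOn (fun x => gB n x + h x) (Ioi (n:ℝ)) := by
  refine strictMonoOn_of_deriv_pos (convex_Ioi _) H.contOn ?_
  intro x hx
  rw [interior_Ioi] at hx
  have hx : (n:ℝ) < x := hx
  rw [(H.dth hx).deriv]
  have := div_pos (sB_pos hx) (pos_of_nlt hx)
  have := mul_nonneg (rhoB_nonneg hx) (sq_nonneg (sin (gB n x + h x)))
  linarith

lemma mono (H : Ph n h) : MonotoneOn h (Ioi (n:ℝ)) := by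
  refine monotoneOn_of_deriv_nonneg (convex_Ioi _)
    (fun _ hx => (H.d _ hx).continuousAt.continuousWithinAt)
    (fun x hx => ?_) ?_
  · rw [interior_Ioi] at hx
    exact (H.d _ hx).differentiableAt.differentiableWithinAt
  intro x hx
  rw [interior_Ioi] at hx
  have hx : (n:ℝ) < x := hx
  rw [(H.d x hx).deriv]
  exact mul_nonneg (rhoB_nonneg hx) (sq_nonneg (sin (gB n x + h x)))

lemma anti (H : Ph n h) {a K : ℝ} (ha : (n:ℝ) < a) (hK : ∀ x, a ≤ x → rhoB n x ≤ K / x^2) :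
    AntitoneOn (fun x => h x + K / x) (Ici a) := by
  have hd : ∀ x, a ≤ x → HasDerivAt (fun x => h x + K / x) (rhoB n x * (sin (gB n x + h x))^2 - K / x^2) x := by
    intro x hx
    have h1 := (hasDerivAt_inv (pos_of_nlt (ha.trans_le hx)).ne').const_mul K
    refine ((H.d x (ha.trans_le hx)).add h1).congr_deriv ?_
    rw [div_eq_mul_inv]; ring
  refine antitoneOn_of_deriv_nonpos (convex_Ici _)
    (fun _ hx => (hd _ hx).continuousAt.continuousWithinAt)
    (fun x hx => ?_) ?_
  · rw [interior_Ici] at hx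
    exact (hd _ (le_of_lt hx)).differentiableAt.differentiableWithinAt
  intro x hx
  rw [interior_Ici] at hx
  have hx : a ≤ x := le_of_lt hx
  rw [(hd x hx).deriv]
  have h1 := rhoB_nonneg (ha.trans_le hx)
  have h2 := hK x hx
  have h3 := Real.sin_sq_le_one (gB n x + h x)
  nlinarith

end Ph

lemma gB_ge {n : ℕ} {x : ℝ} (hx : (n:ℝ) < x) : x - n - n * π ≤ gB n x := by
  have h1 : x - n ≤ sB n x := by
    apply Real.le_sqrt_of_sq_le
    have : (0:ℝ) ≤ n := Nat.cast_nonneg n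
    nlinarith
  have h2 : (n:ℝ) * Real.arccos (n / x) ≤ n * π := by gcongr; exact Real.arccos_le_pi _
  unfold gB; linarith

lemma rhoB_le {β : ℝ} (hβ : 1 < β) : ∃ K : ℝ, 0 < K ∧ ∀ n : ℕ, ∀ x : ℝ, 0 < x → β * n ≤ x →
    rhoB n x ≤ K / x^2 := by
  have hk : 0 < 1 - 1/β^2 := by
    rw [sub_pos, div_lt_one (by positivity)]; nlinarith
  set κ := √(1 - 1/β^2) with hκ
  have hκ0 : 0 < κ := Real.sqrt_pos.2 hk
  refine ⟨(5/4) / κ^5, by positivity, fun n x hx hnx => ?_⟩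
  have hn0 : (0:ℝ) ≤ n := Nat.cast_nonneg n
  have hnx2 : (n:ℝ)^2 ≤ x^2 / β^2 := by
    rw [le_div_iff₀ (by positivity), ← mul_pow, mul_comm]
    gcongr
  have hnx3 : (n:ℝ)^2 ≤ x^2 := by
    refine hnx2.trans (div_le_self (by positivity) ?_); nlinarith
  have hs : κ * x ≤ sB n x := by
    apply Real.le_sqrt_of_sq_le
    rw [mul_pow, hκ, Real.sq_sqrt hk.le]
    have : (1 - 1/β^2) * x^2 = x^2 - x^2/β^2 := by ring
    linarith
  unfold rhoB
  calc (x^3/4 + x*(n:ℝ)^2) / (sB n x)^5 ≤ (x^3/4 + x*x^2) / (κ*x)^5 := by gcongr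
    _ = _ := by field_simp; ring

lemma rhoB_le_one (n : ℕ) : ∃ K : ℝ, 0 < K ∧ ∀ x : ℝ, 2*n+1 ≤ x → rhoB n x ≤ K / x^2 := by
  obtain ⟨K, hK, h⟩ := rhoB_le (β := 2) (by norm_num)
  refine ⟨K, hK, fun x hx => h n x ?_ (by linarith)⟩
  have : (0:ℝ) ≤ n := Nat.cast_nonneg n
  linarith

lemma Ph.exists_lim {n : ℕ} {h : ℝ → ℝ} (H : Ph n h) : ∃ L, Tendsto h atTop (𝓝 L) := by
  obtain ⟨K, hK, hb⟩ := rhoB_le_one n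
  have hn : (0:ℝ) ≤ n := Nat.cast_nonneg n
  have hlt : ∀ x ∈ Ioi (2*(n:ℝ)+1), (n:ℝ) < x := fun x hx => by
    have : 2*(n:ℝ)+1 < x := hx
    linarith
  refine exists_lim_of_deriv_bound (a := 2*n+1) (K := K) (by positivity) (fun x hx => H.d x (hlt x hx)) ?_ ?_
  · intro x hx
    have h1 := rhoB_cont (hlt x hx)
    have h2 := (H.dth (hlt x hx)).continuousAt
    exact (h1.mul ((Real.continuous_sin.continuousAt.comp h2).pow 2)).continuousWithinAt
  · intro x hx
    have h1 := rhoB_nonneg (hlt x hx)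
    have h3 := Real.sin_sq_le_one (gB n x + h x)
    rw [Real.norm_eq_abs, abs_of_nonneg (mul_nonneg h1 (sq_nonneg _))]
    exact (mul_le_of_le_one_right h1 h3).trans (hb x (le_of_lt hx))

lemma Ph.lim_bounds {n : ℕ} {h : ℝ → ℝ} (H : Ph n h) {L : ℝ} (hL : Tendsto h atTop (𝓝 L))
    {a K : ℝ} (ha : (n:ℝ) < a) (hK : ∀ x, a ≤ x → rhoB n x ≤ K / x^2) :
    h a ≤ L ∧ L ≤ h a + K / a := by
  constructor
  · refine ge_of_tendsto hL ?_
    filter_upwards [eventually_ge_atTop a] with x hx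
    exact H.mono ha (ha.trans_le hx) hx
  · have h1 : Tendsto (fun x => h x + K / x) atTop (𝓝 (L + 0)) :=
      hL.add (tendsto_const_nhds.div_atTop tendsto_id)
    rw [add_zero] at h1
    refine le_of_tendsto h1 ?_
    filter_upwards [eventually_ge_atTop a] with x hx
    exact H.anti ha hK self_mem_Ici hx hx

structure IsZeros (n : ℕ) (a : ℕ → ℝ) : Prop where
  pos : ∀ k, 1 ≤ k → 0 < a k
  mono : ∀ k l, 1 ≤ k → k < l → a k < a l
  zero : ∀ k, 1 ≤ k → jb n (a k) = 0
  all : ∀ z, 0 < z → jb n z = 0 → ∃ k, 1 ≤ k ∧ a k = z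

lemma IsZeros.lt_iff {n : ℕ} {a : ℕ → ℝ} (Z : IsZeros n a) {k l : ℕ} (hk : 1 ≤ k) (hl : 1 ≤ l) :
    a k < a l ↔ k < l := by
  constructor
  · intro h
    by_contra hc
    rcases (not_lt.1 hc).eq_or_lt with h1 | h1
    · rw [h1] at h; exact lt_irrefl _ h
    · exact lt_asymm h (Z.mono l k hl h1)
  · exact Z.mono k l hk

lemma IsZeros.le_iff {n : ℕ} {a : ℕ → ℝ} (Z : IsZeros n a) {k l : ℕ} (hk : 1 ≤ k) (hl : 1 ≤ l) :
    a k ≤ a l ↔ k ≤ l := by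
  rw [← not_lt, ← not_lt, Z.lt_iff hl hk]

/-- every level `mπ` above a value taken is attained -/
lemma Ph.exists_level {n : ℕ} {h : ℝ → ℝ} (H : Ph n h) {x0 y : ℝ} (hx0 : (n:ℝ) < x0)
    (hy : gB n x0 + h x0 ≤ y) : ∃ x, x0 ≤ x ∧ gB n x + h x = y := by
  set X := max x0 (y - h x0 + n + n * π) with hX
  have hX0 : x0 ≤ X := le_max_left _ _
  have h1 : y ≤ gB n X + h X := by
    have h2 := gB_ge (hx0.trans_le hX0)
    have h3 := H.mono hx0 (hx0.trans_le hX0) hX0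
    have h4 : y - h x0 + n + n * π ≤ X := le_max_right _ _
    linarith
  have hc : ContinuousOn (fun x => gB n x + h x) (Icc x0 X) :=
    H.contOn.mono fun t ht => hx0.trans_le ht.1
  obtain ⟨x, hx, hxy⟩ := intermediate_value_Icc hX0 hc ⟨hy, h1⟩
  exact ⟨x, hx.1, hxy⟩

lemma Ph.step {n : ℕ} {h : ℝ → ℝ} (H : Ph n h) {a : ℕ → ℝ} (Z : IsZeros n a) {k : ℕ} (hk : 1 ≤ k)
    (hak : (n:ℝ) < a k) : gB n (a (k+1)) + h (a (k+1)) = gB n (a k) + h (a k) + π := by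
  have hlt := Z.mono k (k+1) hk (Nat.lt_succ_self k)
  have hak1 : (n:ℝ) < a (k+1) := hak.trans hlt
  obtain ⟨m, hm⟩ := Real.sin_eq_zero_iff.1 ((H.zero_iff hak).1 (Z.zero k hk))
  obtain ⟨m', hm'⟩ := Real.sin_eq_zero_iff.1 ((H.zero_iff hak1).1 (Z.zero (k+1) (by omega)))
  have hth : gB n (a k) + h (a k) < gB n (a (k+1)) + h (a (k+1)) := H.strictMono hak hak1 hlt
  have hmm : m < m' := by
    rw [← hm, ← hm'] at hth
    exact_mod_cast lt_of_mul_lt_mul_right hth pi_pos.le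
  obtain ⟨x, hx, hxe⟩ := H.exists_level (y := ((m+1:ℤ):ℝ) * π) hak (by
    rw [← hm]; push_cast; nlinarith [pi_pos])
  have hxn : (n:ℝ) < x := hak.trans_le hx
  obtain ⟨i, hi, hia⟩ := Z.all x (pos_of_nlt hxn) ((H.zero_iff hxn).2 (by
    rw [hxe]; exact Real.sin_int_mul_pi _))
  have hki : k < i := by
    rw [← Z.lt_iff hk hi, hia]
    refine lt_of_le_of_ne hx fun he => ?_
    rw [← he, ← hm] at hxe
    push_cast at hxe
    nlinarith [pi_pos]
  have h3 : a (k+1) ≤ x := by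
    rw [← hia]; exact (Z.le_iff (by omega) hi).2 hki
  have h4 := H.strictMono.monotoneOn hak1 hxn h3
  rw [hxe, ← hm'] at h4
  have h5 : m' ≤ m + 1 := by exact_mod_cast le_of_mul_le_mul_right h4 pi_pos
  have h6 : m' = m + 1 := by omega
  rw [← hm', ← hm, h6]; push_cast; ring

lemma Ph.step_many {n : ℕ} {h : ℝ → ℝ} (H : Ph n h) {a : ℕ → ℝ} (Z : IsZeros n a) {k : ℕ} (hk : 1 ≤ k)
    (hak : (n:ℝ) < a k) (i : ℕ) : (n:ℝ) < a (k+i) ∧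
    gB n (a (k+i)) + h (a (k+i)) = gB n (a k) + h (a k) + i * π := by
  induction i with
  | zero => simpa using hak
  | succ i ih =>
    have := H.step Z (k := k+i) (by omega) ih.1
    refine ⟨ih.1.trans (Z.mono _ _ (by omega) (by omega)), ?_⟩
    rw [← add_assoc, this, ih.2]; push_cast; ring

lemma IsZeros.tendsto {n : ℕ} {h : ℝ → ℝ} (H : Ph n h) {a : ℕ → ℝ} (Z : IsZeros n a) :
    Tendsto a atTop atTop := by
  refine tendsto_atTop.2 fun b => ?_
  set x0 := max ((n:ℝ)+1) b
  have hx0 : (n:ℝ) < x0 := lt_of_lt_of_le (by linarith) (le_max_left _ _)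
  obtain ⟨m, hm⟩ := exists_nat_ge ((gB n x0 + h x0) / π)
  rw [div_le_iff₀ pi_pos] at hm
  obtain ⟨x, hx, hxe⟩ := H.exists_level hx0 hm
  obtain ⟨i, hi, hia⟩ := Z.all x (pos_of_nlt (hx0.trans_le hx)) ((H.zero_iff (hx0.trans_le hx)).2 (by
    rw [hxe]; exact Real.sin_nat_mul_pi _))
  filter_upwards [eventually_ge_atTop i] with j hj
  have h1 : a i ≤ a j := (Z.le_iff hi (hi.trans hj)).2 hj
  have h2 : b ≤ x0 := le_max_right _ _
  linarith

lemma numbering {n : ℕ} {a : ℕ → ℝ} (Z : IsZeros n a) : ∃ (Λ : ℝ → ℂ) (m : ℤ), PhC n Λ ∧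
    ∀ k, 1 ≤ k → (n:ℝ) < a k → gB n (a k) + ((Λ (a k)).im + m * π) = k * π := by
  obtain ⟨Λ, hΛ⟩ := phase_exists n
  have HC : PhC n Λ := ⟨fun x hx => (hΛ x hx).1, fun x hx => (hΛ x hx).2⟩
  have H0 := HC.toPh 0
  obtain ⟨k0, hk0, hk0'⟩ := (((IsZeros.tendsto H0 Z).eventually_gt_atTop (n:ℝ)).and (eventually_ge_atTop 1)).exists
  obtain ⟨m0, hm0⟩ := Real.sin_eq_zero_iff.1 ((H0.zero_iff hk0).1 (Z.zero k0 hk0'))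
  refine ⟨Λ, k0 - m0, HC, fun k hk hak => ?_⟩
  have H := HC.toPh (k0 - m0)
  rcases le_total k k0 with hkk | hkk
  · obtain ⟨i, rfl⟩ := Nat.exists_eq_add_of_le hkk
    have := (H.step_many Z hk hak i).2
    push_cast at this hm0 ⊢
    linarith
  · obtain ⟨i, rfl⟩ := Nat.exists_eq_add_of_le hkk
    have := (H.step_many Z hk0' hk0 i).2
    push_cast at this hm0 ⊢
    linarith
end

section
open Real Set Filter Topology MeasureTheory

lemma jb0_d (x : ℝ) : HasDerivAt (jb 0) (-jb 1 x) x := by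
  have h : jb 0 = fun x => phiB 0 (x^2/4) := by ext x; simp [jb]
  rw [h]
  refine (hasDerivAt_phiB_sq 0 x).congr_deriv ?_
  simp [jb]

lemma xjb1_d (x : ℝ) : HasDerivAt (fun x => x * jb 1 x) (x * jb 0 x) x := by
  have h : (fun x => x * jb 1 x) = fun x => x^2/2 * phiB 1 (x^2/4) := by ext x; simp [jb]; ring
  rw [h]
  have h1 := ((hasDerivAt_pow 2 x).div_const 2).mul (hasDerivAt_phiB_sq 1 x)
  refine h1.congr_deriv ?_
  simp only [jb, pow_zero, one_mul]
  rw [← phiB_rec 0]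
  push_cast; ring

lemma jb1_cont : Continuous (jb 1) := by
  refine continuous_iff_continuousAt.2 fun x => ?_
  have h2 := (hasDerivAt_phiB_sq 1 x).continuousAt
  unfold jb
  exact ((continuous_id.div_const 2).pow 1).continuousAt.mul h2

lemma jb0_cont : Continuous (jb 0) := continuous_iff_continuousAt.2 fun x => (jb0_d x).continuousAt

lemma jb0_zero : jb 0 0 = 1 := by
  unfold jb phiB
  rw [tsum_eq_single 0]
  · simp [phiC]
  · intro m hm; simp [hm]

lemma jb1_zero : jb 1 0 = 0 := by simp [jb]

lemma energy {x : ℝ} (hx : 0 ≤ x) : (jb 0 x)^2 + (jb 1 x)^2 ≤ 1 := by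
  have hd : ∀ x : ℝ, 0 < x → HasDerivAt (fun x => (jb 0 x)^2 + (jb 1 x)^2) (-2 * (jb 1 x)^2 / x) x := by
    intro x hx
    have h1 := ((jb0_d x).pow 2).add ((hasDerivAt_jb_succ 0 hx).pow 2)
    refine h1.congr_deriv ?_
    push_cast
    field_simp
    ring
  have : AntitoneOn (fun x => (jb 0 x)^2 + (jb 1 x)^2) (Ici 0) := by
    refine antitoneOn_of_deriv_nonpos (convex_Ici _)
      ((jb0_cont.pow 2).add (jb1_cont.pow 2)).continuousOn (fun x hx => ?_) ?_
    · rw [interior_Ici] at hx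
      exact (hd _ hx).differentiableAt.differentiableWithinAt
    intro x hx
    rw [interior_Ici] at hx
    have hx : 0 < x := hx
    rw [(hd x hx).deriv]
    apply div_nonpos_of_nonpos_of_nonneg _ hx.le
    nlinarith [sq_nonneg (jb 1 x)]
  have := this self_mem_Ici hx hx
  simp only [jb0_zero, jb1_zero] at this
  linarith

lemma jb0_le {x : ℝ} (hx : 0 ≤ x) : |jb 0 x| ≤ 1 :=
  abs_le_one_iff_mul_self_le_one.2 (by nlinarith [energy hx, sq_nonneg (jb 1 x)])

lemma jb1_le {x : ℝ} (hx : 0 ≤ x) : |jb 1 x| ≤ 1 :=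
  abs_le_one_iff_mul_self_le_one.2 (by nlinarith [energy hx, sq_nonneg (jb 0 x)])

noncomputable def kerB (ε x : ℝ) : ℂ := Complex.exp (-(((ε:ℂ) - Complex.I) * x))

lemma norm_kerB (ε x : ℝ) : ‖kerB ε x‖ = exp (-ε * x) := by
  unfold kerB
  rw [Complex.norm_exp]
  simp

lemma kerB_d (ε x : ℝ) : HasDerivAt (kerB ε) (-((ε:ℂ) - Complex.I) * kerB ε x) x := by
  unfold kerB
  have h1 : HasDerivAt (fun x : ℝ => -(((ε:ℂ) - Complex.I) * x)) (-((ε:ℂ) - Complex.I)) x := by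
    have := ((hasDerivAt_id (x:ℂ)).const_mul ((ε:ℂ) - Complex.I)).neg.comp_ofReal
    simpa using this
  refine h1.cexp.congr_deriv ?_
  ring

lemma kerB_d' (ε x : ℝ) : HasDerivAt (fun ε => kerB ε x) (-(x:ℂ) * kerB ε x) ε := by
  unfold kerB
  have h1 : HasDerivAt (fun ε : ℝ => -(((ε:ℂ) - Complex.I) * x)) (-(x:ℂ)) ε := by
    have := (((hasDerivAt_id (ε:ℂ)).sub_const Complex.I).mul_const (x:ℂ)).neg.comp_ofReal
    simpa using this
  refine h1.cexp.congr_deriv ?_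
  ring

lemma kerB_cont (ε : ℝ) : Continuous (kerB ε) := continuous_iff_continuousAt.2 fun x => (kerB_d ε x).continuousAt

lemma x_exp_le {ε x : ℝ} (hε : 0 < ε) : x * exp (-ε * x) ≤ 2 / ε * exp (-(ε/2) * x) := by
  have h1 : ε / 2 * x ≤ exp (ε/2 * x) := by linarith [Real.add_one_le_exp (ε/2*x)]
  have h2 : exp (-ε * x) = exp (-(ε/2) * x) * exp (-(ε/2)*x) := by rw [← Real.exp_add]; ring_nf
  have h3 : exp (ε/2*x) * exp (-(ε/2)*x) = 1 := by rw [← Real.exp_add]; ring_nf; simp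
  have h4 := Real.exp_pos (-(ε/2) * x)
  rw [h2]
  have h5 : x ≤ 2/ε * exp (ε/2*x) := by
    rw [div_mul_eq_mul_div, le_div_iff₀ hε]; linarith
  calc x * (exp (-(ε/2) * x) * exp (-(ε/2)*x)) ≤ (2/ε * exp (ε/2*x)) * (exp (-(ε/2) * x) * exp (-(ε/2)*x)) := by gcongr
    _ = 2/ε * exp (-(ε/2)*x) * (exp (ε/2*x) * exp (-(ε/2)*x)) := by ring
    _ = _ := by rw [h3, mul_one]

lemma intg_of_le {f : ℝ → ℂ} (hf : Continuous f) {C ε : ℝ} (hε : 0 < ε)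
    (h : ∀ x, 0 < x → ‖f x‖ ≤ C * exp (-ε * x)) : IntegrableOn f (Ioi 0) := by
  refine Integrable.mono' ((exp_neg_integrableOn_Ioi 0 hε).const_mul C) hf.aestronglyMeasurable ?_
  exact (ae_restrict_iff' measurableSet_Ioi).2 (Eventually.of_forall h)

lemma k0_le {ε x : ℝ} (hx : 0 < x) : ‖kerB ε x * jb 0 x‖ ≤ 1 * exp (-ε * x) := by
  rw [norm_mul, norm_kerB, Complex.norm_real, Real.norm_eq_abs, mul_comm]
  gcongr; exact jb0_le hx.le

lemma k1_le {ε x : ℝ} (hx : 0 < x) : ‖kerB ε x * jb 1 x‖ ≤ 1 * exp (-ε * x) := by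
  rw [norm_mul, norm_kerB, Complex.norm_real, Real.norm_eq_abs, mul_comm]
  gcongr; exact jb1_le hx.le

lemma xk0_le {ε x : ℝ} (hε : 0 < ε) (hx : 0 < x) : ‖(x:ℂ) * (kerB ε x * jb 0 x)‖ ≤ 2 / ε * exp (-(ε/2) * x) := by
  rw [norm_mul, Complex.norm_real, Real.norm_eq_abs, abs_of_pos hx]
  refine le_trans ?_ (x_exp_le hε)
  gcongr
  simpa using k0_le (ε := ε) hx

lemma xk1_le {ε x : ℝ} (hε : 0 < ε) (hx : 0 < x) : ‖(x:ℂ) * (kerB ε x * jb 1 x)‖ ≤ 2 / ε * exp (-(ε/2) * x) := by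
  rw [norm_mul, Complex.norm_real, Real.norm_eq_abs, abs_of_pos hx]
  refine le_trans ?_ (x_exp_le hε)
  gcongr
  simpa using k1_le (ε := ε) hx

lemma cj (n : ℕ) (h : Continuous (jb n)) : Continuous (fun x => (jb n x : ℂ)) := Complex.continuous_ofReal.comp h

lemma k0_int {ε : ℝ} (hε : 0 < ε) : IntegrableOn (fun x => kerB ε x * jb 0 x) (Ioi 0) :=
  intg_of_le ((kerB_cont ε).mul (cj 0 jb0_cont)) hε fun _ hx => k0_le hx

lemma k1_int {ε : ℝ} (hε : 0 < ε) : IntegrableOn (fun x => kerB ε x * jb 1 x) (Ioi 0) :=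
  intg_of_le ((kerB_cont ε).mul (cj 1 jb1_cont)) hε fun _ hx => k1_le hx

lemma xk0_int {ε : ℝ} (hε : 0 < ε) : IntegrableOn (fun x : ℝ => (x:ℂ) * (kerB ε x * jb 0 x)) (Ioi 0) :=
  intg_of_le (Complex.continuous_ofReal.mul ((kerB_cont ε).mul (cj 0 jb0_cont))) (half_pos hε) fun _ hx => xk0_le hε hx

lemma tend_of_le {f : ℝ → ℂ} {C ε : ℝ} (hε : 0 < ε)
    (h : ∀ x, 0 < x → ‖f x‖ ≤ C * exp (-ε * x)) : Tendsto f atTop (𝓝 0) := by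
  have h1 : Tendsto (fun x => C * exp (-ε * x)) atTop (𝓝 (C * 0)) := by
    refine Tendsto.const_mul C (Real.tendsto_exp_atBot.comp ?_)
    exact tendsto_id.const_mul_atTop_of_neg (by linarith)
  rw [mul_zero] at h1
  refine squeeze_zero_norm' ?_ h1
  filter_upwards [eventually_gt_atTop 0] with x hx using h x hx

noncomputable def lapB (ε : ℝ) : ℂ := ∫ x in Ioi (0:ℝ), kerB ε x * jb 0 x
noncomputable def lapX (ε : ℝ) : ℂ := ∫ x in Ioi (0:ℝ), (x:ℂ) * (kerB ε x * jb 0 x)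
noncomputable def lap1 (ε : ℝ) : ℂ := ∫ x in Ioi (0:ℝ), kerB ε x * jb 1 x

lemma lap_rel {ε : ℝ} (hε : 0 < ε) :
    ((ε:ℂ) - Complex.I) * lapB ε = (1 + ((ε:ℂ) - Complex.I)^2) * lapX ε := by
  set s := (ε:ℂ) - Complex.I with hs
  have hd : ∀ x ∈ Ioi (0:ℝ), HasDerivAt (fun x : ℝ => kerB ε x * (-((x * jb 1 x : ℝ) : ℂ) + s * ((x:ℂ) * (jb 0 x : ℝ))))
      (s * (kerB ε x * jb 0 x) - (1+s^2) * ((x:ℂ) * (kerB ε x * jb 0 x))) x := by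
    intro x hx
    have h1 := (xjb1_d x).ofReal_comp.neg
    have h2 := ((Complex.ofRealCLM.hasDerivAt (x := x)).mul (jb0_d x).ofReal_comp).const_mul s
    have h3 := (kerB_d ε x).mul (h1.add h2)
    refine HasDerivAt.congr_deriv h3 ?_
    simp only [Pi.add_apply, Pi.neg_apply, Pi.mul_apply, Complex.ofRealCLM_apply]
    push_cast
    ring
  have hi : IntegrableOn (fun x : ℝ => s * (kerB ε x * jb 0 x) - (1+s^2) * ((x:ℂ) * (kerB ε x * jb 0 x))) (Ioi 0) :=
    ((k0_int hε).const_mul s).sub ((xk0_int hε).const_mul _)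
  have ht : Tendsto (fun x : ℝ => kerB ε x * (-((x * jb 1 x : ℝ) : ℂ) + s * ((x:ℂ) * (jb 0 x : ℝ)))) atTop (𝓝 0) := by
    have h1 := (tend_of_le (half_pos hε) fun x hx => xk1_le hε hx).neg
    have h2 := (tend_of_le (half_pos hε) fun x hx => xk0_le hε hx).const_mul s
    have := h1.add h2
    simp only [neg_zero, mul_zero, add_zero] at this
    refine this.congr fun x => ?_
    push_cast; ring
  have key := integral_Ioi_of_hasDerivAt_of_tendsto ?_ hd hi ht
  · rw [integral_sub ((k0_int hε).const_mul s) ((xk0_int hε).const_mul _),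
      integral_const_mul, integral_const_mul] at key
    simp only [Complex.ofReal_zero, zero_mul, mul_zero, neg_zero, add_zero, sub_zero] at key
    unfold lapB lapX
    linear_combination key
  · apply Continuous.continuousWithinAt
    have := kerB_cont ε
    have := cj 0 jb0_cont
    have := cj 1 jb1_cont
    push_cast
    fun_prop

lemma lap_one {ε : ℝ} (hε : 0 < ε) : ((ε:ℂ) - Complex.I) * lapB ε + lap1 ε = 1 := by
  set s := (ε:ℂ) - Complex.I with hs
  have hd : ∀ x ∈ Ioi (0:ℝ), HasDerivAt (fun x : ℝ => kerB ε x * (jb 0 x : ℝ))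
      (-s * (kerB ε x * jb 0 x) - (kerB ε x * jb 1 x)) x := by
    intro x hx
    have h3 := (kerB_d ε x).mul (jb0_d x).ofReal_comp
    refine HasDerivAt.congr_deriv h3 ?_
    push_cast
    ring
  have hi := ((k0_int hε).const_mul (-s)).sub (k1_int hε)
  have ht : Tendsto (fun x : ℝ => kerB ε x * (jb 0 x : ℝ)) atTop (𝓝 0) := tend_of_le hε fun x hx => k0_le hx
  have key := integral_Ioi_of_hasDerivAt_of_tendsto ?_ hd hi ht
  · have e := integral_sub ((k0_int hε).const_mul (-s)) (k1_int hε)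
    rw [integral_const_mul] at e
    have e2 := e.symm.trans key
    unfold lapB lap1
    have e3 : kerB ε 0 = 1 := by simp [kerB]
    rw [e3, jb0_zero] at e2
    push_cast at e2
    linear_combination -e2
  · exact ((kerB_cont ε).mul (cj 0 jb0_cont)).continuousWithinAt

lemma norm_lap_le {ε : ℝ} (hε : 0 < ε) {f : ℝ → ℂ} (h : ∀ x, 0 < x → ‖f x‖ ≤ 1 * exp (-ε * x)) :
    ‖∫ x in Ioi (0:ℝ), f x‖ ≤ 1/ε := by
  refine (norm_integral_le_of_norm_le ((exp_neg_integrableOn_Ioi 0 hε).const_mul 1)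
    ((ae_restrict_iff' measurableSet_Ioi).2 (Eventually.of_forall h))).trans (le_of_eq ?_)
  rw [integral_const_mul, integral_exp_mul_Ioi (by linarith)]
  simp

lemma lapB_d {ε : ℝ} (hε : 0 < ε) : HasDerivAt lapB (-lapX ε) ε := by
  have key := hasDerivAt_integral_of_dominated_loc_of_deriv_le (μ := volume.restrict (Ioi (0:ℝ)))
    (F := fun ε x => kerB ε x * (jb 0 x : ℂ)) (F' := fun ε x => -((x:ℂ) * (kerB ε x * jb 0 x))) (x₀ := ε)
    (s := Ioi (ε/2)) (bound := fun x => 2 / (ε/2) * exp (-(ε/2/2) * x)) (Ioi_mem_nhds (by linarith))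
    (Eventually.of_forall fun e => ((kerB_cont e).mul (cj 0 jb0_cont)).aestronglyMeasurable)
    (k0_int hε) (xk0_int hε).neg.aestronglyMeasurable ?_ ?_ ?_
  · refine key.2.congr_deriv ?_
    rw [integral_neg]; rfl
  · refine (ae_restrict_iff' measurableSet_Ioi).2 (Eventually.of_forall fun x hx e he => ?_)
    have hx : 0 < x := hx
    have he : ε/2 < e := he
    rw [norm_neg, norm_mul, Complex.norm_real, Real.norm_eq_abs, abs_of_pos hx]
    refine le_trans ?_ (x_exp_le (half_pos hε))
    gcongr
    refine (k0_le hx).trans ?_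
    rw [one_mul]
    gcongr
  · exact (exp_neg_integrableOn_Ioi 0 (by linarith)).const_mul _
  · refine Eventually.of_forall fun x e _ => ?_
    refine ((kerB_d' e x).mul_const _).congr_deriv ?_
    ring

lemma lapB_sq {ε : ℝ} (hε : 0 < ε) : (lapB ε)^2 * (1 + ((ε:ℂ) - Complex.I)^2) = 1 := by
  set G : ℝ → ℂ := fun ε => (lapB ε)^2 * (1 + ((ε:ℂ) - Complex.I)^2) with hG
  have hGd : ∀ ε ∈ Ioi (0:ℝ), HasDerivAt G 0 ε := by
    intro ε hε
    have h1 := ((Complex.ofRealCLM.hasDerivAt (x := ε)).sub_const Complex.I).pow 2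
    have h2 := ((lapB_d hε).pow 2).mul (h1.const_add 1)
    refine HasDerivAt.congr_deriv h2 ?_
    have := lap_rel hε
    simp only [Pi.pow_apply, Complex.ofRealCLM_apply]
    push_cast
    linear_combination (2 * lapB ε) * this
  have hconst : ∀ e : ℝ, 0 < e → G e = G ε := by
    intro e he
    refine (convex_Ioi (0:ℝ)).is_const_of_fderivWithin_eq_zero (𝕜 := ℝ) (f := G)
      (fun y hy => (hGd y hy).differentiableAt.differentiableWithinAt) ?_ he hε
    intro y hy
    have := (hGd y hy).hasFDerivAt.hasFDerivWithinAt (s := Ioi (0:ℝ)) |>.fderivWithin (isOpen_Ioi.uniqueDiffWithinAt hy)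
    rw [this]; ext; simp
  have hinv : Tendsto (fun e : ℝ => 1/e) atTop (𝓝 0) := tendsto_const_nhds.div_atTop tendsto_id
  have hB : Tendsto lapB atTop (𝓝 0) := by
    refine squeeze_zero_norm' ?_ hinv
    filter_upwards [eventually_gt_atTop 0] with e he using norm_lap_le he fun x hx => k0_le hx
  have h1 : Tendsto lap1 atTop (𝓝 0) := by
    refine squeeze_zero_norm' ?_ hinv
    filter_upwards [eventually_gt_atTop 0] with e he using norm_lap_le he fun x hx => k1_le hx
  have h2 : Tendsto (fun e => (1 - lap1 e)^2 + (lapB e)^2) atTop (𝓝 ((1-0)^2 + 0^2)) :=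
    ((tendsto_const_nhds.sub h1).pow 2).add (hB.pow 2)
  have h3 : Tendsto G atTop (𝓝 ((1-0)^2 + 0^2)) := by
    refine h2.congr' ?_
    filter_upwards [eventually_gt_atTop 0] with e he
    have := lap_one he
    have h5 : 1 - lap1 e = ((e:ℂ) - Complex.I) * lapB e := by linear_combination -this
    simp only [hG]
    rw [h5]; ring
  have h4 : Tendsto G atTop (𝓝 (G ε)) := by
    refine tendsto_const_nhds.congr' ?_
    filter_upwards [eventually_gt_atTop 0] with e he using (hconst e he).symm
  have := tendsto_nhds_unique h4 h3
  rw [← hG] at *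
  simpa using this
end

section
open Real Set Filter Topology MeasureTheory

noncomputable def leadB (ζ : ℂ) (y : ℝ) : ℝ := (ζ * Complex.exp ((y^2 : ℝ) * Complex.I)).im
noncomputable def etaB (ζ : ℂ) (y : ℝ) : ℝ := y * jb 0 (y^2) - leadB ζ y

lemma leadB_le (ζ : ℂ) (y : ℝ) : |leadB ζ y| ≤ ‖ζ‖ := by
  unfold leadB
  refine (Complex.abs_im_le_norm _).trans ?_
  rw [norm_mul, Complex.norm_exp_ofReal_mul_I, mul_one]

lemma leadB_cont (ζ : ℂ) : Continuous (leadB ζ) := by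
  unfold leadB; fun_prop

lemma etaB_cont (ζ : ℂ) : Continuous (etaB ζ) := by
  unfold etaB
  have h1 := leadB_cont ζ
  have h2 : Continuous fun y : ℝ => jb 0 (y^2) := jb0_cont.comp (by fun_prop)
  fun_prop

lemma sB_zero {x : ℝ} (hx : 0 < x) : sB 0 x = x := by
  simp [sB, Real.sqrt_sq hx.le]

lemma gB_zero {x : ℝ} (hx : 0 < x) : gB 0 x = x := by
  simp [gB, sB_zero hx]

lemma etaB_eq {Λ : ℝ → ℂ} (H : PhC 0 Λ) (ζ : ℂ) {y : ℝ} (hy : 0 < y) :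
    |etaB ζ y| ≤ ‖Complex.exp (Λ (y^2)) - ζ‖ := by
  have hy2 : 0 < y^2 := by positivity
  have h := (H.vw (x := y^2) (by simpa using hy2)).1
  rw [vB, sB_zero hy2, gB_zero hy2, Real.sqrt_sq hy.le] at h
  have h1 : y * jb 0 (y^2) = (Complex.exp (Λ (y^2)) * Complex.exp ((y^2 : ℝ) * Complex.I)).im := by
    rw [← Complex.exp_add, Complex.exp_im]
    simp only [Complex.add_re, Complex.add_im, Complex.mul_re, Complex.mul_im, Complex.I_re, Complex.I_im,
      Complex.ofReal_re, Complex.ofReal_im]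
    have : y * (y * jb 0 (y^2)) = y * (exp (Λ (y^2)).re * sin (y^2 + (Λ (y^2)).im)) := by
      linear_combination h
    have := mul_left_cancel₀ hy.ne' this
    rw [this]
    congr 2 <;> ring
  unfold etaB leadB
  rw [h1, ← Complex.sub_im, ← sub_mul]
  refine (Complex.abs_im_le_norm _).trans ?_
  rw [norm_mul, Complex.norm_exp_ofReal_mul_I, mul_one]

lemma etaB_bound {Λ : ℝ → ℂ} (H : PhC 0 Λ) {M : ℂ} (hM : Tendsto Λ atTop (𝓝 M)) {δ : ℝ} (hδ : 0 < δ) :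
    ∃ C, 0 ≤ C ∧ ∀ y, 0 < y → |etaB (Complex.exp M) y| ≤ δ + C * exp (-1 * y^2) := by
  have h1 : Tendsto (fun y : ℝ => ‖Complex.exp (Λ (y^2)) - Complex.exp M‖) atTop (𝓝 0) := by
    have h2 : Tendsto (fun y : ℝ => y^2) atTop atTop := tendsto_pow_atTop (by norm_num)
    have h3 := ((Complex.continuous_exp.tendsto M).comp (hM.comp h2)).sub_const (Complex.exp M)
    rw [sub_self] at h3
    simpa using h3.norm
  obtain ⟨R, hR⟩ := eventually_atTop.1 (h1.eventually_lt_const hδ)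
  set R' := max R 0
  refine ⟨(R' + ‖Complex.exp M‖) * exp (R'^2), by positivity, fun y hy => ?_⟩
  rcases le_or_gt R y with hy1 | hy1
  · have := (etaB_eq H (Complex.exp M) hy).trans (hR y hy1).le
    have h4 : 0 ≤ (R' + ‖Complex.exp M‖) * exp (R'^2) * exp (-1 * y^2) := by positivity
    linarith
  · have hyR : y ≤ R' := hy1.le.trans (le_max_left _ _)
    have h5 : |etaB (Complex.exp M) y| ≤ R' + ‖Complex.exp M‖ := by
      unfold etaB
      refine (abs_sub _ _).trans (add_le_add ?_ (leadB_le _ _))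
      rw [abs_mul, abs_of_pos hy]
      have := jb0_le (x := y^2) (by positivity)
      calc y * |jb 0 (y^2)| ≤ y * 1 := by gcongr
        _ ≤ R' := by linarith
    have h6 : 1 ≤ exp (R'^2) * exp (-1*y^2) := by
      rw [← exp_add]
      apply Real.one_le_exp
      nlinarith
    have h7 : 0 ≤ R' + ‖Complex.exp M‖ := by positivity
    rw [mul_assoc]
    nlinarith

lemma lapB_sub (ε : ℝ) : lapB ε = 2 * ∫ y in Ioi (0:ℝ), kerB ε (y^2) * (y * jb 0 (y^2) : ℝ) := by
  unfold lapB
  rw [← integral_comp_rpow_Ioi_of_pos (p := 2) (by norm_num), ← integral_const_mul]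
  refine setIntegral_congr_fun measurableSet_Ioi fun y hy => ?_
  have h2 : y ^ (2:ℝ) = y^2 := by norm_cast
  have h1 : y ^ ((2:ℝ) - 1) = y := by norm_num
  simp only [h2, h1]
  rw [Complex.real_smul]
  push_cast; ring

lemma ker_lead (ζ : ℂ) (ε y : ℝ) : kerB ε (y^2) * (leadB ζ y : ℝ) =
    ζ / (2 * Complex.I) * Complex.exp (-((ε:ℂ) - 2 * Complex.I) * (y:ℂ)^2)
    - (starRingEnd ℂ) ζ / (2 * Complex.I) * Complex.exp (-(ε:ℂ) * (y:ℂ)^2) := by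
  have h : ((leadB ζ y : ℝ) : ℂ) = (ζ * Complex.exp ((y:ℂ)^2 * Complex.I) -
      (starRingEnd ℂ) ζ * Complex.exp (-((y:ℂ)^2 * Complex.I))) / (2 * Complex.I) := by
    unfold leadB
    rw [Complex.im_eq_sub_conj, map_mul, ← Complex.exp_conj]
    simp
  rw [h]
  unfold kerB
  have e1 : Complex.exp (-((ε:ℂ) - 2 * Complex.I) * (y:ℂ)^2) =
      Complex.exp (-(((ε:ℂ) - Complex.I) * ((y^2:ℝ):ℂ))) * Complex.exp ((y:ℂ)^2 * Complex.I) := by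
    rw [← Complex.exp_add]; congr 1; push_cast; ring
  have e2 : Complex.exp (-(ε:ℂ) * (y:ℂ)^2) =
      Complex.exp (-(((ε:ℂ) - Complex.I) * ((y^2:ℝ):ℂ))) * Complex.exp (-((y:ℂ)^2 * Complex.I)) := by
    rw [← Complex.exp_add]; congr 1; push_cast; ring
  rw [e1, e2]; ring

lemma ker_bound {Λ : ℝ → ℂ} (H : PhC 0 Λ) {M : ℂ} (hM : Tendsto Λ atTop (𝓝 M)) {δ : ℝ} (hδ : 0 < δ) :
    ∃ C, 0 ≤ C ∧ ∀ ε, 0 < ε → ‖(√ε : ℂ) * lapB ε + (starRingEnd ℂ) (Complex.exp M) * √π / (2 * Complex.I)‖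
      ≤ δ * √π + C * √ε := by
  obtain ⟨C, hC, hb⟩ := etaB_bound H hM hδ
  set ζ := Complex.exp M
  refine ⟨‖ζ‖ / 2 * √π + C * √π, by positivity, fun ε hε => ?_⟩
  have hre1 : 0 < ((ε:ℂ) - 2 * Complex.I).re := by simpa using hε
  have hre2 : 0 < (ε:ℂ).re := by simpa using hε
  have i1 := (integrable_cexp_neg_mul_sq hre1).integrableOn (s := Ioi 0)
  have i2 := (integrable_cexp_neg_mul_sq hre2).integrableOn (s := Ioi 0)
  have r1 := (integrable_exp_neg_mul_sq hε).integrableOn (s := Ioi 0)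
  have r2 := (integrable_exp_neg_mul_sq (show 0 < ε + 1 by linarith)).integrableOn (s := Ioi 0)
  have hle : ∀ y ∈ Ioi (0:ℝ), ‖kerB ε (y^2) * (etaB ζ y : ℝ)‖ ≤
      δ * exp (-ε * y^2) + C * exp (-(ε+1) * y^2) := by
    intro y hy
    rw [norm_mul, norm_kerB, Complex.norm_real, Real.norm_eq_abs]
    have e : exp (-(ε+1)*y^2) = exp (-ε*y^2) * exp (-1*y^2) := by rw [← exp_add]; ring_nf
    rw [e]
    have := mul_le_mul_of_nonneg_left (hb y hy) (exp_pos (-ε*y^2)).le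
    linarith
  have rint := (r1.const_mul δ).add (r2.const_mul C)
  have i3 : IntegrableOn (fun y : ℝ => kerB ε (y^2) * (etaB ζ y : ℝ)) (Ioi 0) := by
    refine Integrable.mono' rint ?_ ((ae_restrict_iff' measurableSet_Ioi).2 (Eventually.of_forall hle))
    have h1 : Continuous fun y : ℝ => kerB ε (y^2) := (kerB_cont ε).comp (by fun_prop)
    exact (h1.mul (Complex.continuous_ofReal.comp (etaB_cont ζ))).aestronglyMeasurable
  have hsplit : lapB ε = ζ / (2 * Complex.I) * ((π / ((ε:ℂ) - 2 * Complex.I)) ^ (1/2 : ℂ))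
      - (starRingEnd ℂ) ζ / (2 * Complex.I) * (√(π/ε) : ℝ)
      + 2 * ∫ y in Ioi (0:ℝ), kerB ε (y^2) * (etaB ζ y : ℝ) := by
    rw [lapB_sub]
    have : ∀ y : ℝ, kerB ε (y^2) * (y * jb 0 (y^2) : ℝ) =
       (ζ / (2 * Complex.I) * Complex.exp (-((ε:ℂ) - 2 * Complex.I) * (y:ℂ)^2)
        - (starRingEnd ℂ) ζ / (2 * Complex.I) * Complex.exp (-(ε:ℂ) * (y:ℂ)^2))
        + kerB ε (y^2) * (etaB ζ y : ℝ) := by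
      intro y
      rw [← ker_lead]
      unfold etaB
      push_cast; ring
    simp_rw [this]
    have g2 : ∫ y in Ioi (0:ℝ), Complex.exp (-(ε:ℂ) * (y:ℂ)^2) = ((√(π/ε)/2 : ℝ) : ℂ) := by
      rw [← integral_gaussian_Ioi, ← integral_complex_ofReal]
      refine integral_congr_ae (Eventually.of_forall fun y => ?_)
      push_cast; rfl
    have i12 : IntegrableOn (fun y : ℝ => ζ / (2 * Complex.I) * Complex.exp (-((ε:ℂ) - 2 * Complex.I) * (y:ℂ)^2)
        - (starRingEnd ℂ) ζ / (2 * Complex.I) * Complex.exp (-(ε:ℂ) * (y:ℂ)^2)) (Ioi 0) :=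
      (i1.const_mul _).sub (i2.const_mul _)
    rw [integral_add i12 i3, integral_sub (i1.const_mul _) (i2.const_mul _), integral_const_mul, integral_const_mul,
      integral_gaussian_complex_Ioi hre1, g2]
    push_cast; ring
  have hE : ‖2 * ∫ y in Ioi (0:ℝ), kerB ε (y^2) * (etaB ζ y : ℝ)‖ ≤ δ * √(π/ε) + C * √(π/(ε+1)) := by
    rw [norm_mul]
    have := norm_integral_le_of_norm_le rint ((ae_restrict_iff' measurableSet_Ioi).2 (Eventually.of_forall hle))
    have h2 : ∫ y in Ioi (0:ℝ), ((fun x => δ * exp (-ε * x^2)) + fun x => C * exp (-(ε+1) * x^2)) y =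
      δ * (√(π/ε)/2) + C * (√(π/(ε+1))/2) := by
      simp only [Pi.add_apply]
      rw [integral_add (r1.const_mul δ) (r2.const_mul C), integral_const_mul, integral_const_mul,
        integral_gaussian_Ioi, integral_gaussian_Ioi]
    rw [h2] at this
    simp only [Complex.norm_ofNat]
    linarith
  have hsε : 0 < √ε := Real.sqrt_pos.2 hε
  have hsq : √ε * √(π/ε) = √π := by
    rw [← Real.sqrt_mul hε.le]; congr 1; field_simp
  have hq : ‖(π / ((ε:ℂ) - 2 * Complex.I)) ^ (1/2 : ℂ)‖ ≤ √π := by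
    apply Real.le_sqrt_of_sq_le
    rw [← norm_pow, ← Complex.cpow_nat_mul]
    norm_num
    have h2 : 2 ≤ ‖(ε:ℂ) - 2 * Complex.I‖ := by
      have := Complex.abs_im_le_norm ((ε:ℂ) - 2 * Complex.I)
      simpa using this
    rw [abs_of_pos pi_pos]
    exact div_le_self pi_pos.le (by linarith)
  have hq2 : √(π/(ε+1)) ≤ √π := by
    apply Real.sqrt_le_sqrt
    exact div_le_self pi_pos.le (by linarith)
  have hform : (√ε : ℂ) * lapB ε + (starRingEnd ℂ) ζ * √π / (2 * Complex.I) =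
     (√ε : ℂ) * (ζ / (2 * Complex.I)) * ((π / ((ε:ℂ) - 2 * Complex.I)) ^ (1/2 : ℂ)) +
      (√ε : ℂ) * (2 * ∫ y in Ioi (0:ℝ), kerB ε (y^2) * (etaB ζ y : ℝ)) := by
    rw [hsplit, ← hsq]; push_cast; ring
  rw [hform]
  refine (norm_add_le _ _).trans ?_
  rw [norm_mul, norm_mul, norm_mul, Complex.norm_real, Real.norm_eq_abs, abs_of_pos hsε]
  have hz : ‖ζ / (2 * Complex.I)‖ = ‖ζ‖/2 := by simp
  rw [hz]
  have k1 : √ε * (‖ζ‖/2) * ‖(π / ((ε:ℂ) - 2 * Complex.I)) ^ (1/2 : ℂ)‖ ≤ √ε * (‖ζ‖/2) * √π := by gcongr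
  have k2 : √ε * ‖2 * ∫ y in Ioi (0:ℝ), kerB ε (y^2) * (etaB ζ y : ℝ)‖ ≤
      √ε * (δ * √(π/ε) + C * √π) := by
    gcongr
    refine hE.trans ?_
    gcongr
  have k3 : √ε * (δ * √(π/ε) + C * √π) = δ * √π + C * √π * √ε := by rw [← hsq]; ring
  nlinarith

lemma base_im {Λ : ℝ → ℂ} (H : PhC 0 Λ) {M : ℂ} (hM : Tendsto Λ atTop (𝓝 M)) :
    ∃ m : ℤ, M.im = π/4 + m * π := by
  set ζ := Complex.exp M with hζ
  set B : ℂ := (starRingEnd ℂ) ζ * √π / (2 * Complex.I) with hB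
  have hlim : Tendsto (fun ε : ℝ => (√ε : ℂ) * lapB ε + B) (𝓝[>] 0) (𝓝 0) := by
    rw [tendsto_zero_iff_norm_tendsto_zero]
    refine (tendsto_order.2 ⟨fun a ha => Eventually.of_forall fun ε => ha.trans_le (norm_nonneg _), fun a ha => ?_⟩)
    have hπ : 0 < √π := Real.sqrt_pos.2 pi_pos
    obtain ⟨C, hC, hb⟩ := ker_bound H hM (δ := a / (2 * √π)) (by positivity)
    have h1 : Tendsto (fun ε : ℝ => a / (2 * √π) * √π + C * √ε) (𝓝[>] 0) (𝓝 (a / (2 * √π) * √π + C * √0)) := by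
      have : Continuous fun ε : ℝ => a / (2 * √π) * √π + C * √ε := by fun_prop
      exact (this.tendsto 0).mono_left nhdsWithin_le_nhds
    have h2 : a / (2 * √π) * √π + C * √0 < a := by
      rw [Real.sqrt_zero, mul_zero, add_zero]
      have : a / (2 * √π) * √π = a/2 := by field_simp
      linarith
    filter_upwards [h1.eventually_lt_const h2, self_mem_nhdsWithin] with ε h3 h4
    exact (hb ε h4).trans_lt h3
  have hlim2 : Tendsto (fun ε : ℝ => ((√ε : ℂ) * lapB ε)^2 * ((ε:ℂ) - 2 * Complex.I)) (𝓝[>] 0)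
      (𝓝 ((0 - B)^2 * ((0:ℝ) - 2 * Complex.I))) := by
    have h1 := (hlim.sub_const B).pow 2
    have h2 : Tendsto (fun ε : ℝ => (ε:ℂ) - 2 * Complex.I) (𝓝[>] 0) (𝓝 (((0:ℝ):ℂ) - 2 * Complex.I)) := by
      have : Continuous fun ε : ℝ => (ε:ℂ) - 2 * Complex.I := by fun_prop
      exact (this.tendsto 0).mono_left nhdsWithin_le_nhds
    refine (h1.mul h2).congr fun ε => ?_
    ring
  have hone : Tendsto (fun ε : ℝ => ((√ε : ℂ) * lapB ε)^2 * ((ε:ℂ) - 2 * Complex.I)) (𝓝[>] 0) (𝓝 1) := by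
    refine tendsto_const_nhds.congr' ?_
    filter_upwards [self_mem_nhdsWithin] with ε hε
    have h1 := lapB_sq hε
    have h2 : ((√ε : ℝ) : ℂ)^2 = ε := by
      rw [← Complex.ofReal_pow, Real.sq_sqrt (le_of_lt hε)]
    rw [mul_pow, h2, ← h1]
    linear_combination ((lapB ε)^2) * Complex.I_sq
  have heq := tendsto_nhds_unique hlim2 hone
  have hπ2 : ((√π : ℝ) : ℂ)^2 = π := by
    rw [← Complex.ofReal_pow, Real.sq_sqrt pi_pos.le]
  have h3 : ((starRingEnd ℂ) ζ)^2 * π * Complex.I = 2 := by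
    rw [hB] at heq
    have : (0 - (starRingEnd ℂ) ζ * √π / (2 * Complex.I))^2 = -(((starRingEnd ℂ) ζ)^2 * π)/4 := by
      have hi : (2 * Complex.I)^2 = -4 := by rw [mul_pow, Complex.I_sq]; norm_num
      rw [zero_sub, neg_sq, div_pow, hi, mul_pow, hπ2]; ring
    rw [this] at heq
    simp at heq
    linear_combination 2 * heq
  have h4 : (starRingEnd ℂ) ζ ^2 = Complex.exp ((2 * M.re : ℝ) + (-(2 * M.im) : ℝ) * Complex.I) := by
    rw [hζ, ← Complex.exp_conj, ← Complex.exp_nat_mul]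
    congr 1
    apply Complex.ext <;> simp
  rw [h4] at h3
  have him := congrArg Complex.im h3
  have hre := congrArg Complex.re h3
  simp only [Complex.mul_im, Complex.mul_re, Complex.exp_im, Complex.exp_re, Complex.I_re, Complex.I_im,
    Complex.ofReal_re, Complex.ofReal_im, Complex.add_re, Complex.add_im] at him hre
  simp at him hre
  have hcos : cos (2 * M.im) = 0 := by
    exact him
  have hsin : 0 < sin (2 * M.im) := by
    have : 0 < exp (2 * M.re) * π := by positivity
    by_contra hc
    nlinarith
  have hs1 : sin (2 * M.im) = 1 := by
    have := Real.sin_sq_add_cos_sq (2 * M.im)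
    rw [hcos] at this
    nlinarith
  have hc1 : cos (2 * M.im - π/2) = 1 := by rw [Real.cos_sub_pi_div_two, hs1]
  obtain ⟨m, hm⟩ := (Real.cos_eq_one_iff _).1 hc1
  exact ⟨m, by linarith⟩
end

section
open Real Set Filter Topology MeasureTheory

lemma PhC.exists_lim {n : ℕ} {Λ : ℝ → ℂ} (H : PhC n Λ) : ∃ M, Tendsto Λ atTop (𝓝 M) := by
  obtain ⟨K, hK, hb⟩ := rhoB_le_one n
  have hn : (0:ℝ) ≤ n := Nat.cast_nonneg n
  have hlt : ∀ x ∈ Ioi (2*(n:ℝ)+1), (n:ℝ) < x := fun x hx => by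
    have : 2*(n:ℝ)+1 < x := hx
    linarith
  refine exists_lim_of_deriv_bound (a := 2*n+1) (K := K) (by positivity) (fun x hx => H.d x (hlt x hx)) ?_ ?_
  · intro x hx
    have h1 := rhoB_cont (hlt x hx)
    have h2 := (hasDerivAt_vB (hlt x hx)).continuousAt
    have h3 := (hasDerivAt_zB (hlt x hx)).continuousAt
    exact ((Complex.continuous_ofReal.continuousAt.comp (h1.mul h2)).neg.div h3
      (zB_ne (hlt x hx))).continuousWithinAt
  · intro x hx
    exact (PhC.deriv_norm_le (hlt x hx)).trans (hb x (le_of_lt hx))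

def Good (n : ℕ) (a : ℕ → ℝ) (h : ℝ → ℝ) : Prop :=
  Ph n h ∧ (∀ k, 1 ≤ k → (n:ℝ) < a k → gB n (a k) + h (a k) = k * π) ∧ Tendsto h atTop (𝓝 (π/4))

lemma good_zero {a : ℕ → ℝ} (Z : IsZeros 0 a) : ∃ h, Good 0 a h := by
  obtain ⟨Λ, m, HC, hnum⟩ := numbering Z
  have H := HC.toPh m
  obtain ⟨M, hM⟩ := HC.exists_lim
  obtain ⟨m1, hm1⟩ := base_im HC hM
  have hL : Tendsto (fun x => (Λ x).im + m * π) atTop (𝓝 (M.im + m * π)) :=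
    ((Complex.continuous_im.tendsto M).comp hM).add_const _
  refine ⟨_, H, hnum, ?_⟩
  set h : ℝ → ℝ := fun x => (Λ x).im + m * π with hh
  have hj : ∀ x : ℝ, 0 < x → x ≤ 1 → jb 0 x ≠ 0 := by
    intro x hx hx1 h0
    have := phiB_pos_of_lt 0 (x^2/4) (by positivity) (by push_cast; nlinarith)
    simp [jb] at h0
    linarith
  have ha1 : 1 < a 1 := by
    by_contra hc
    exact hj (a 1) (Z.pos 1 le_rfl) (not_lt.1 hc) (Z.zero 1 le_rfl)
  have h01 : ((0:ℕ):ℝ) < 1 := by simp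
  have h0a : ((0:ℕ):ℝ) < a 1 := h01.trans ha1
  have hth := H.strictMono h01 h0a ha1
  have hth1 := hnum 1 le_rfl h0a
  have e1 := gB_zero (x := 1) one_pos
  have hup : 1 + h 1 < π := by
    have : gB 0 1 + h 1 < gB 0 (a 1) + h (a 1) := hth
    rw [e1] at this
    have : gB 0 (a 1) + h (a 1) = π := by simpa [hh] using hth1
    linarith
  have hlow : 0 < 1 + h 1 := by
    by_contra hc
    obtain ⟨x, hx, hxe⟩ := H.exists_level (y := 0) h01 (by
      show gB 0 1 + h 1 ≤ 0
      rw [e1]; linarith)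
    have hx0 : ((0:ℕ):ℝ) < x := h01.trans_le hx
    have hz := (H.zero_iff hx0).2 (by rw [hxe]; exact Real.sin_zero)
    obtain ⟨i, hi, hia⟩ := Z.all x (by linarith) hz
    have hge : a 1 ≤ x := by rw [← hia]; exact (Z.le_iff le_rfl hi).2 hi
    have := H.strictMono.monotoneOn h0a hx0 hge
    have h3 : gB 0 (a 1) + h (a 1) ≤ gB 0 x + h x := this
    have h4 : gB 0 (a 1) + h (a 1) = π := by simpa [hh] using hth1
    have h5 : gB 0 x + h x = 0 := hxe
    linarith [pi_pos]
  have hrho : ∀ x : ℝ, 1 ≤ x → rhoB 0 x ≤ (1/4) / x^2 := by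
    intro x hx
    have hx0 : 0 < x := by linarith
    unfold rhoB
    rw [sB_zero hx0]
    apply le_of_eq
    simp
    field_simp
  obtain ⟨l1, l2⟩ := H.lim_bounds hL h01 hrho
  have l1' : h 1 ≤ M.im + m * π := l1
  have l2' : M.im + m * π ≤ h 1 + (1/4)/1 := l2
  rw [hm1] at l1' l2' 
  have hk : m1 + m = 0 := by
    have hp3 := pi_gt_three
    have hp4 := pi_lt_four
    have u1 : ((m1 + m : ℤ):ℝ) * π < 1 * π := by push_cast; linarith
    have u2 : (-1) * π < ((m1 + m : ℤ):ℝ) * π := by push_cast; linarith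
    have v1 := lt_of_mul_lt_mul_right u1 pi_pos.le
    have v2 := lt_of_mul_lt_mul_right u2 pi_pos.le
    have v1' : m1 + m < 1 := by exact_mod_cast v1
    have v2' : -1 < m1 + m := by exact_mod_cast v2
    omega
  have hk' : (m1:ℝ) + m = 0 := by exact_mod_cast hk
  have : M.im + m * π = π/4 := by rw [hm1]; linear_combination π * hk'
  rw [this] at hL
  exact hL

lemma interlace {n : ℕ} {a b : ℕ → ℝ} (Z : IsZeros n a) (Z' : IsZeros (n+1) b) :
    ∀ k, 1 ≤ k → a k < b k ∧ b k < a (k+1) := by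
  intro k hk
  induction k, hk using Nat.le_induction with
  | base =>
    constructor
    · obtain ⟨c, hc0, hc1, hc⟩ := rolle_down n le_rfl (Z'.pos 1 le_rfl) (Or.inl rfl) (Z'.zero 1 le_rfl)
      obtain ⟨i, hi, rfl⟩ := Z.all c hc0 hc
      exact ((Z.le_iff le_rfl hi).2 hi).trans_lt hc1
    · obtain ⟨c, hc0, hc1, hc⟩ := rolle_up n (Z.pos 1 le_rfl) (Z.mono 1 2 le_rfl (by omega)) (Z.zero 1 le_rfl)
        (Z.zero 2 (by omega))
      obtain ⟨i, hi, rfl⟩ := Z'.all c ((Z.pos 1 le_rfl).trans hc0) hc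
      exact ((Z'.le_iff le_rfl hi).2 hi).trans_lt hc1
  | succ k hk ih =>
    have hk1 : 1 ≤ k + 1 := by omega
    constructor
    · obtain ⟨c, hc0, hc1, hc⟩ := rolle_down n (Z'.pos k hk).le (Z'.mono k (k+1) hk (by omega))
        (Or.inr (Z'.zero k hk)) (Z'.zero (k+1) hk1)
      obtain ⟨i, hi, rfl⟩ := Z.all c ((Z'.pos k hk).trans hc0) hc
      have : k < i := (Z.lt_iff hk hi).1 (ih.1.trans hc0)
      exact ((Z.le_iff hk1 hi).2 this).trans_lt hc1
    · obtain ⟨c, hc0, hc1, hc⟩ := rolle_up n (Z.pos (k+1) hk1) (Z.mono (k+1) (k+1+1) hk1 (by omega))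
        (Z.zero (k+1) hk1) (Z.zero (k+1+1) (by omega))
      obtain ⟨i, hi, rfl⟩ := Z'.all c ((Z.pos (k+1) hk1).trans hc0) hc
      have : k < i := (Z'.lt_iff hk hi).1 (ih.2.trans hc0)
      exact ((Z'.le_iff hk1 hi).2 this).trans_lt hc1

lemma gB_lim (n : ℕ) : Tendsto (fun x => gB n x - x) atTop (𝓝 (-(n * (π/2)))) := by
  have h1 : Tendsto (fun x => sB n x - x) atTop (𝓝 0) := by
    have hl : Tendsto (fun x : ℝ => -((n:ℝ)^2 / x)) atTop (𝓝 0) := by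
      have : Tendsto (fun x : ℝ => (n:ℝ)^2 / x) atTop (𝓝 0) := tendsto_const_nhds.div_atTop tendsto_id
      simpa using this.neg
    refine tendsto_of_tendsto_of_tendsto_of_le_of_le' hl tendsto_const_nhds ?_ ?_
    · filter_upwards [eventually_gt_atTop (n:ℝ)] with x hx
      have hx0 := pos_of_nlt hx
      have : x - (n:ℝ)^2/x ≤ sB n x := by
        apply Real.le_sqrt_of_sq_le
        have e : (x - (n:ℝ)^2/x)^2 = x^2 - 2*(n:ℝ)^2 + (n:ℝ)^2 * ((n:ℝ)^2/x^2) := by field_simp; ring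
        have e2 : (n:ℝ)^2/x^2 ≤ 1 := by
          rw [div_le_one (by positivity)]
          have := sB_arg_pos hx
          linarith
        have e3 : (n:ℝ)^2 * ((n:ℝ)^2/x^2) ≤ (n:ℝ)^2 * 1 := by gcongr
        linarith
      linarith
    · filter_upwards [eventually_gt_atTop (n:ℝ)] with x hx
      have hx0 := pos_of_nlt hx
      have : sB n x ≤ x := by
        apply Real.sqrt_le_iff.2 ⟨hx0.le, ?_⟩
        nlinarith [sq_nonneg (n:ℝ)]
      linarith
  have h2 : Tendsto (fun x : ℝ => (n:ℝ) * Real.arccos (n / x)) atTop (𝓝 (n * (π/2))) := by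
    have : Tendsto (fun x : ℝ => (n:ℝ) / x) atTop (𝓝 0) := tendsto_const_nhds.div_atTop tendsto_id
    have h3 := (Real.continuous_arccos.tendsto 0).comp this
    rw [Real.arccos_zero] at h3
    exact h3.const_mul _
  have := h1.sub h2
  rw [zero_sub] at this
  refine this.congr fun x => ?_
  unfold gB; ring

lemma good_succ {n : ℕ} {a b : ℕ → ℝ} (Z : IsZeros n a) (Z' : IsZeros (n+1) b) {h : ℝ → ℝ}
    (G : Good n a h) : ∃ h', Good (n+1) b h' := by
  obtain ⟨H, hnum, hlim⟩ := G
  obtain ⟨Λ, m, HC, hnum'⟩ := numbering Z'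
  have H' := HC.toPh m
  set h' : ℝ → ℝ := fun x => (Λ x).im + m * π with hh'
  refine ⟨h', H', hnum', ?_⟩
  obtain ⟨L, hL⟩ := H'.exists_lim
  have hbT := IsZeros.tendsto H' Z'
  have haT := IsZeros.tendsto H Z
  have hn0 : (0:ℝ) ≤ n := Nat.cast_nonneg n
  have hil := interlace Z Z'
  set d : ℕ → ℝ := fun k => gB n (b k) + h (b k) - k * π - π/2 with hd
  have hev : ∀ᶠ k in atTop, 1 ≤ k ∧ (n:ℝ) < a k ∧ ((n+1:ℕ):ℝ) < b k ∧ 2*(n:ℝ)+1 ≤ b k := by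
    filter_upwards [eventually_ge_atTop 1, haT.eventually_gt_atTop (n:ℝ),
      hbT.eventually_gt_atTop ((n+1:ℕ):ℝ), hbT.eventually_ge_atTop (2*(n:ℝ)+1)] with k h1 h2 h3 h4
    exact ⟨h1, h2, h3, h4⟩
  have hdb : ∀ᶠ k in atTop, d k ∈ Ioo (-(π/2)) (π/2) ∧ |sin (d k)| ≤ ((n+2)*2) / b k := by
    filter_upwards [hev] with k ⟨h1, h2, h3, h4⟩
    obtain ⟨i1, i2⟩ := hil k h1
    have hbn : (n:ℝ) < b k := h2.trans i1
    have t1 := H.strictMono h2 hbn i1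
    have t2 := H.strictMono hbn (hbn.trans i2) i2
    have t1' : gB n (a k) + h (a k) < gB n (b k) + h (b k) := t1
    have t2' : gB n (b k) + h (b k) < gB n (a (k+1)) + h (a (k+1)) := t2
    rw [hnum k h1 h2] at t1'
    rw [hnum (k+1) (by omega) (hbn.trans i2)] at t2'
    push_cast at t2'
    have hmem : d k ∈ Ioo (-(π/2)) (π/2) := by
      simp only [hd]
      constructor <;> linarith
    refine ⟨hmem, ?_⟩
    have hcosd : 0 < cos (d k) := Real.cos_pos_of_mem_Ioo hmem
    have hth : gB n (b k) + h (b k) = d k + π/2 + (k:ℤ) * π := by simp only [hd]; push_cast; ring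
    have hrel := H.rel (b k) hbn
    rw [hth, Real.sin_add_int_mul_pi, Real.cos_add_int_mul_pi, Real.cos_add_pi_div_two, Real.sin_add_pi_div_two] at hrel
    have hpm : ((-1:ℝ)^(k:ℤ)) ≠ 0 := by positivity
    have hrel2 : vB n (b k) * (- sin (d k)) = wB n (b k) * cos (d k) := by
      apply mul_left_cancel₀ hpm
      linear_combination hrel
    have hj : jb n (b k) ≠ 0 := by
      intro h0
      rw [H.zero_iff hbn, hth, Real.sin_add_int_mul_pi, Real.sin_add_pi_div_two] at h0
      rcases mul_eq_zero.1 h0 with h0 | h0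
      · exact hpm h0
      · exact hcosd.ne' h0
    unfold vB wB at hrel2
    rw [Z'.zero k h1] at hrel2
    have hS := sB_pos hbn
    have hrel3 : sB n (b k) * (- sin (d k)) = (n + (b k)^2 / (2 * (sB n (b k))^2)) * cos (d k) := by
      apply mul_left_cancel₀ hj
      linear_combination hrel2
    have hx0 := pos_of_nlt hbn
    have hS2 : b k / 2 ≤ sB n (b k) := by
      have : b k - n ≤ sB n (b k) := by
        apply Real.le_sqrt_of_sq_le
        nlinarith
      linarith
    have hq : (b k)^2 / (2 * (sB n (b k))^2) ≤ 2 := by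
      rw [div_le_iff₀ (by positivity)]
      nlinarith
    have hq0 : 0 ≤ (b k)^2 / (2 * (sB n (b k))^2) := by positivity
    have habs : sB n (b k) * |sin (d k)| ≤ n + 2 := by
      have := congrArg abs hrel3
      rw [abs_mul, abs_neg, abs_of_pos hS, abs_mul,
        abs_of_nonneg (add_nonneg hn0 hq0)] at this
      rw [this]
      calc _ ≤ ((n:ℝ) + (b k)^2 / (2 * (sB n (b k))^2)) * 1 := by
            gcongr
            exact Real.abs_cos_le_one _
        _ ≤ n + 2 := by linarith
    rw [le_div_iff₀ hx0]
    nlinarith [abs_nonneg (sin (d k))]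
  have hsin0 : Tendsto (fun k => sin (d k)) atTop (𝓝 0) := by
    refine squeeze_zero_norm' (a := fun k => ((n+2)*2) / b k) ?_ (tendsto_const_nhds.div_atTop hbT)
    filter_upwards [hdb] with k hk
    exact hk.2
  have hd0 : Tendsto d atTop (𝓝 0) := by
    have := (Real.continuous_arcsin.tendsto 0).comp hsin0
    rw [Real.arcsin_zero] at this
    refine this.congr' ?_
    filter_upwards [hdb] with k hk
    exact Real.arcsin_sin hk.1.1.le hk.1.2.le
  have hval : ∀ᶠ k in atTop, (gB n (b k) - b k) - (gB (n+1) (b k) - b k) + h (b k) - π/2 - d k = h' (b k) := by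
    filter_upwards [hev] with k ⟨h1, h2, h3, h4⟩
    have := hnum' k h1 h3
    have h5 : gB (n+1) (b k) + h' (b k) = k * π := this
    simp only [hd]
    linarith
  have hl1 := (((((gB_lim n).comp hbT).sub ((gB_lim (n+1)).comp hbT)).add (hlim.comp hbT)).sub_const (π/2)).sub hd0
  have hl2 := (hl1.congr' hval)
  have := tendsto_nhds_unique hl2 (hL.comp hbT)
  have e : L = π/4 := by
    rw [← this]; push_cast; ring
  rw [e] at hL
  exact hL

lemma good_all {a : ℕ → ℕ → ℝ} (Z : ∀ n, IsZeros n (a n)) : ∀ n, ∃ h, Good n (a n) h := by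
  intro n
  induction n with
  | zero => exact good_zero (Z 0)
  | succ n ih =>
    obtain ⟨h, hh⟩ := ih
    exact good_succ (Z n) (Z (n+1)) hh
end

section
open Real Set Filter Topology MeasureTheory

lemma gB_scale {n : ℕ} (hn : 1 ≤ n) {γ : ℝ} (hγ : 1 < γ) :
    gB n (γ * n) = n * (√(γ^2 - 1) - Real.arccos (1/γ)) := by
  have hn0 : (0:ℝ) < n := by exact_mod_cast hn
  have e1 : sB n (γ * n) = n * √(γ^2-1) := by
    unfold sB
    rw [show (γ * n)^2 - (n:ℝ)^2 = (n:ℝ)^2 * (γ^2-1) by ring, Real.sqrt_mul (by positivity),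
      Real.sqrt_sq hn0.le]
  have e2 : (n:ℝ) / (γ * n) = 1 / γ := by field_simp
  unfold gB
  rw [e1, e2]; ring

lemma gB_strictMono (n : ℕ) : StrictMonoOn (gB n) (Ioi (n:ℝ)) := by
  refine strictMonoOn_of_deriv_pos (convex_Ioi _)
    (fun x hx => (hasDerivAt_gB hx).continuousAt.continuousWithinAt) ?_
  intro x hx
  rw [interior_Ioi] at hx
  have hx : (n:ℝ) < x := hx
  rw [(hasDerivAt_gB hx).deriv]
  exact div_pos (sB_pos hx) (pos_of_nlt hx)

lemma gB_lip (n : ℕ) : MonotoneOn (fun x => x - gB n x) (Ioi (n:ℝ)) := by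
  have hd : ∀ x : ℝ, (n:ℝ) < x → HasDerivAt (fun x => x - gB n x) (1 - sB n x / x) x :=
    fun x hx => (hasDerivAt_id x).sub (hasDerivAt_gB hx)
  refine monotoneOn_of_deriv_nonneg (convex_Ioi _)
    (fun x hx => (hd x hx).continuousAt.continuousWithinAt)
    (fun x hx => ?_) ?_
  · rw [interior_Ioi] at hx
    exact (hd _ hx).differentiableAt.differentiableWithinAt
  intro x hx
  rw [interior_Ioi] at hx
  have hx : (n:ℝ) < x := hx
  rw [(hd x hx).deriv, sub_nonneg, div_le_one (pos_of_nlt hx)]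
  apply Real.sqrt_le_iff.2 ⟨(pos_of_nlt hx).le, ?_⟩
  nlinarith [sq_nonneg (n:ℝ)]

lemma gB_abs {n : ℕ} {x y : ℝ} (hx : (n:ℝ) < x) (hy : (n:ℝ) < y) : |gB n x - gB n y| ≤ |x - y| := by
  rcases le_total x y with h | h
  · have h1 := (gB_strictMono n).monotoneOn hx hy h
    have h2 : x - gB n x ≤ y - gB n y := gB_lip n hx hy h
    rw [abs_of_nonpos (by linarith), abs_of_nonpos (by linarith)]; linarith
  · have h1 := (gB_strictMono n).monotoneOn hy hx h
    have h2 : y - gB n y ≤ x - gB n x := gB_lip n hy hx h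
    rw [abs_of_nonneg (by linarith), abs_of_nonneg (by linarith)]; linarith

lemma phase_bound {a : ℕ → ℕ → ℝ} (Z : ∀ n, IsZeros n (a n)) {β : ℝ} (hβ : 1 < β) :
    ∃ K : ℝ, 0 < K ∧ ∀ n k : ℕ, 1 ≤ k → (n:ℝ) < a n k → β * n ≤ a n k →
      |k * π - π/4 - gB n (a n k)| ≤ K / a n k := by
  obtain ⟨K, hK, hb⟩ := rhoB_le hβ
  refine ⟨K, hK, fun n k hk h1 h2 => ?_⟩
  obtain ⟨h, H, hnum, hlim⟩ := good_all Z n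
  have h3 := hnum k hk h1
  obtain ⟨l1, l2⟩ := H.lim_bounds hlim h1 (K := K) (fun x hx =>
    hb n x ((pos_of_nlt h1).trans_le hx) (h2.trans hx))
  have : 0 < K / a n k := div_pos hK (pos_of_nlt h1)
  rw [abs_le]
  constructor <;> linarith

lemma fin_pairs {a : ℕ → ℕ → ℝ} (Z : ∀ n, IsZeros n (a n)) (N : ℕ) (R : ℝ) :
    {x : ℕ × ℕ | x.1 < N ∧ a x.1 x.2 ≤ R}.Finite := by
  have h1 : ∀ n, {k : ℕ | a n k ≤ R}.Finite := by
    intro n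
    obtain ⟨h, H, -, -⟩ := good_all Z n
    have := (IsZeros.tendsto H (Z n)).eventually_gt_atTop R
    rw [← Nat.cofinite_eq_atTop, eventually_cofinite] at this
    simpa using this
  have h2 := (Set.finite_lt_nat N).biUnion (t := fun n => (Prod.mk n) '' {k : ℕ | a n k ≤ R})
    (fun n _ => (h1 n).image _)
  refine h2.subset ?_
  rintro ⟨n, k⟩ ⟨h3, h4⟩
  simp only [mem_iUnion]
  exact ⟨n, h3, k, h4, rfl⟩

lemma fin_min {ι : Type*} {s : Set ι} (hs : s.Finite) (f : ι → ℝ) (hf : ∀ i ∈ s, 0 < f i) :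
    ∃ c, 0 < c ∧ ∀ i ∈ s, c ≤ f i := by
  rcases s.eq_empty_or_nonempty with rfl | hne
  · exact ⟨1, one_pos, by simp⟩
  · obtain ⟨i, hi, hm⟩ := Set.exists_min_image s f hs hne
    exact ⟨f i, hf i hi, hm⟩

lemma key_gap {a : ℕ → ℕ → ℝ} (Z : ∀ n, IsZeros n (a n)) {α : ℝ} (hα : 1 < α)
    {p q : ℕ} (hp : 0 < p) (hq : 0 < q) (hpq : sigmaF α = (p:ℝ)/q) (h4 : 4 ∣ p) :
    ∃ (N : ℕ) (d : ℝ), 0 < d ∧ ∀ n k : ℕ, N ≤ n → 1 ≤ k →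
      (n:ℝ) ≠ sigmaF α * k - sigmaF α / 4 → d ≤ |a n k - α * n| := by
  have hp0 : (0:ℝ) < p := by exact_mod_cast hp
  have hq0 : (0:ℝ) < q := by exact_mod_cast hq
  set τ := √(α^2 - 1) - Real.arccos (1/α) with hτ
  have hτ1 : τ = π * q / p := by
    have h1 : π / τ = p / q := hpq
    have hτ0 : τ ≠ 0 := by
      intro h0
      rw [h0, div_zero] at h1
      have : (0:ℝ) < p / q := by positivity
      linarith
    field_simp at h1 ⊢
    linarith
  obtain ⟨K, hK, hb⟩ := phase_bound Z (β := (1+α)/2) (by linarith)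
  set d := π / (2 * p) with hd
  have hd0 : 0 < d := by positivity
  obtain ⟨N1, hN1⟩ := exists_nat_gt (d / ((α-1)/2))
  obtain ⟨N2, hN2⟩ := exists_nat_gt (K / d)
  refine ⟨max 1 (max N1 N2), d, hd0, fun n k hn hk hne => ?_⟩
  by_contra hc
  push Not at hc
  have hn1 : 1 ≤ n := (le_max_left _ _).trans hn
  have hnN1 : (N1:ℝ) ≤ n := by exact_mod_cast (le_max_left _ _).trans ((le_max_right _ _).trans hn)
  have hnN2 : (N2:ℝ) ≤ n := by exact_mod_cast (le_max_right _ _).trans ((le_max_right _ _).trans hn)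
  have hn0 : (0:ℝ) < n := by exact_mod_cast hn1
  rw [div_lt_iff₀ (by linarith)] at hN1
  rw [div_lt_iff₀ hd0] at hN2
  obtain ⟨c1, c2⟩ := abs_lt.1 hc
  have hβ : (1+α)/2 * n ≤ a n k := by nlinarith
  have hlt : (n:ℝ) < a n k := by nlinarith
  have hαn : (n:ℝ) < α * n := by nlinarith
  have h1 := hb n k hk hlt hβ
  have h2 := gB_abs hlt hαn
  rw [gB_scale hn1 hα, ← hτ] at h2
  have h3 : K / a n k < d := by
    rw [div_lt_iff₀ (pos_of_nlt hlt)]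
    nlinarith
  have h5 : |(k:ℝ) * π - π/4 - n * τ| < 2 * d := by
    have e : (k:ℝ) * π - π/4 - n * τ = (k * π - π/4 - gB n (a n k)) + (gB n (a n k) - n * τ) := by ring
    rw [e]
    refine (abs_add_le _ _).trans_lt ?_
    linarith
  obtain ⟨p', rfl⟩ := h4
  set M : ℤ := 4 * p' * k - p' - n * q with hM
  have hM0 : M ≠ 0 := by
    intro h0
    apply hne
    have h0' : (4 * p' * k - p' - n * q : ℝ) = 0 := by
      have : ((M:ℤ):ℝ) = 0 := by rw [h0]; simp
      rw [hM] at this; push_cast at this; exact this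
    rw [hpq]
    push_cast
    field_simp
    linarith
  have hM1 : (1:ℝ) ≤ |(M:ℝ)| := by
    have := Int.one_le_abs hM0
    exact_mod_cast this
  have e : (k:ℝ) * π - π/4 - n * τ = π / ((4 * p' : ℕ):ℝ) * M := by
    have hp1 : (0:ℝ) < p' := by push_cast at hp0; linarith
    rw [hτ1, hM]; push_cast; field_simp
  rw [e, abs_mul, abs_of_pos (by positivity)] at h5
  have e2 : 2 * d = π / ((4 * p' : ℕ):ℝ) := by rw [hd]; field_simp
  rw [e2] at h5
  have : 0 < π / ((4 * p' : ℕ):ℝ) := by positivity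
  nlinarith

lemma main_c {a : ℕ → ℕ → ℝ} (Z : ∀ n, IsZeros n (a n)) {α : ℝ} (hα : 1 < α)
    {p q : ℕ} (hp : 0 < p) (hq : 0 < q) (hpq : sigmaF α = (p:ℝ)/q) (h4 : 4 ∣ p) :
    ∃ c : ℝ, 0 < c ∧ ∀ n k : ℕ, 1 ≤ k →
      (n:ℝ) ≠ sigmaF α * k - sigmaF α / 4 →
      (a n k)^2 - α^2*(n:ℝ)^2 = 0 ∨ c * a n k ≤ |(a n k)^2 - α^2*(n:ℝ)^2| := by
  obtain ⟨N, d, hd, hgap⟩ := key_gap Z hα hp hq hpq h4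
  have hfin := fin_pairs Z N (α * N + d)
  have hfin2 : {x : ℕ × ℕ | (x.1 < N ∧ a x.1 x.2 ≤ α * N + d) ∧ 1 ≤ x.2 ∧
      (a x.1 x.2)^2 - α^2*(x.1:ℝ)^2 ≠ 0}.Finite := hfin.subset fun x hx => hx.1
  obtain ⟨c1, hc1, hmin⟩ := fin_min hfin2
    (fun x => |(a x.1 x.2)^2 - α^2*(x.1:ℝ)^2| / a x.1 x.2)
    (fun x hx => div_pos (abs_pos.2 hx.2.2) ((Z x.1).pos x.2 hx.2.1))
  refine ⟨min c1 d, lt_min hc1 hd, fun n k hk hne => ?_⟩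
  have hpos := (Z n).pos k hk
  have hn0 : (0:ℝ) ≤ n := Nat.cast_nonneg n
  by_cases hdd : d ≤ |a n k - α * n|
  · right
    have e : (a n k)^2 - α^2*(n:ℝ)^2 = (a n k - α * n) * (a n k + α * n) := by ring
    have hs : 0 ≤ α * n := by positivity
    rw [e, abs_mul, abs_of_pos (show 0 < a n k + α * n by linarith)]
    calc min c1 d * a n k ≤ d * a n k := by gcongr; exact min_le_right _ _
      _ ≤ |a n k - α * n| * (a n k + α * n) := by gcongr; linarith
  · by_cases h0 : (a n k)^2 - α^2*(n:ℝ)^2 = 0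
    · left; exact h0
    · right
      have hnN : n < N := by
        by_contra hc
        exact hdd (hgap n k (not_lt.1 hc) hk hne)
      push Not at hdd
      have h1 := (abs_lt.1 hdd).2
      have hnN' : (n:ℝ) ≤ N := by exact_mod_cast hnN.le
      have h2 : α * n ≤ α * N := by gcongr
      have h3 := hmin (n, k) ⟨⟨hnN, by simp only; linarith⟩, hk, h0⟩
      simp only at h3
      rw [le_div_iff₀ hpos] at h3
      refine le_trans ?_ h3
      gcongr
      exact min_le_left _ _

lemma first_zero {a : ℕ → ℕ → ℝ} (Z : ∀ n, IsZeros n (a n)) {α : ℝ} (hα : 1 < α) :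
    ∃ γ : ℝ, 1 < γ ∧ γ < α ∧ ∃ N : ℕ, ∀ n, N ≤ n → a n 1 ≤ γ * n := by
  set γ1 := (2+α)/3 with hγ1
  set γ2 := (1+2*α)/3 with hγ2
  have g1 : 1 < γ1 := by rw [hγ1]; linarith
  have g2 : 1 < γ2 := by rw [hγ2]; linarith
  have g12 : γ1 < γ2 := by rw [hγ1, hγ2]; linarith
  refine ⟨γ2, g2, by rw [hγ2]; linarith, ?_⟩
  set T : ℝ → ℝ := fun γ => √(γ^2 - 1) - Real.arccos (1/γ) with hT
  have hT12 : T γ1 < T γ2 := by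
    have h1 := gB_scale (n := 1) le_rfl g1
    have h2 := gB_scale (n := 1) le_rfl g2
    have h3 := gB_strictMono 1 (show ((1:ℕ):ℝ) < γ1 by simpa using g1) (show ((1:ℕ):ℝ) < γ2 by simpa using g2) g12
    simp only [Nat.cast_one, mul_one, one_mul] at h1 h2
    rw [h1, h2] at h3
    exact h3
  obtain ⟨N, hN⟩ := exists_nat_gt (π / (T γ2 - T γ1))
  rw [div_lt_iff₀ (by linarith)] at hN
  refine ⟨max 1 N, fun n hn => ?_⟩
  have hn1 : 1 ≤ n := (le_max_left _ _).trans hn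
  have hnN : (N:ℝ) ≤ n := by exact_mod_cast (le_max_right _ _).trans hn
  have hn0 : (0:ℝ) < n := by exact_mod_cast hn1
  obtain ⟨h, H, -, -⟩ := good_all Z n
  have x1 : (n:ℝ) < γ1 * n := by nlinarith
  have x2 : (n:ℝ) < γ2 * n := by nlinarith
  have x12 : γ1 * n ≤ γ2 * n := by nlinarith
  have e1 : gB n (γ1 * n) = n * T γ1 := gB_scale hn1 g1
  have e2 : gB n (γ2 * n) = n * T γ2 := gB_scale hn1 g2
  have hm := H.mono x1 x2 x12
  have hinc : gB n (γ1 * n) + h (γ1 * n) + π < gB n (γ2 * n) + h (γ2 * n) := by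
    rw [e1, e2]
    nlinarith
  set m : ℤ := ⌈(gB n (γ1 * n) + h (γ1 * n)) / π⌉ with hmdef
  have m1 := Int.le_ceil ((gB n (γ1 * n) + h (γ1 * n)) / π)
  have m2 := Int.ceil_lt_add_one ((gB n (γ1 * n) + h (γ1 * n)) / π)
  rw [← hmdef, div_le_iff₀ pi_pos] at m1
  rw [← hmdef] at m2
  have m3 : (m:ℝ) * π < gB n (γ1 * n) + h (γ1 * n) + π := by
    have := mul_lt_mul_of_pos_right m2 pi_pos
    rw [add_mul, div_mul_cancel₀ _ pi_ne_zero] at this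
    linarith
  obtain ⟨x, hx, hxe⟩ := H.exists_level x1 m1
  have hxn : (n:ℝ) < x := x1.trans_le hx
  have hx2 : x < γ2 * n := by
    by_contra hc
    have := H.strictMono.monotoneOn x2 hxn (not_lt.1 hc)
    have h3 : gB n (γ2 * n) + h (γ2 * n) ≤ gB n x + h x := this
    linarith
  obtain ⟨i, hi, hia⟩ := (Z n).all x (pos_of_nlt hxn) ((H.zero_iff hxn).2 (by
    rw [hxe]; exact Real.sin_int_mul_pi _))
  have := ((Z n).le_iff le_rfl hi).2 hi
  linarith

theorem main_all {a : ℕ → ℕ → ℝ} (Z : ∀ n, IsZeros n (a n)) {α : ℝ} (hα : 1 < α)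
    {p q : ℕ} (hp : 0 < p) (hq : 0 < q) (hpq : sigmaF α = (p:ℝ)/q) (h4 : 4 ∣ p)
    (S : Set ℝ)
    (hS : S = {y : ℝ | ∃ n k : ℕ, 1 ≤ k ∧ (n:ℝ) ≠ sigmaF α * k - sigmaF α / 4 ∧
      y = (a n k)^2 - α^2*(n:ℝ)^2}) :
    (∃ c : ℝ, 0 < c ∧ ∀ n : ℕ, ∀ k : ℕ, 1 ≤ k →
        (n:ℝ) ≠ sigmaF α * k - sigmaF α / 4 →
        (a n k)^2 - α^2*(n:ℝ)^2 = 0 ∨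
        c * a n k ≤ |(a n k)^2 - α^2*(n:ℝ)^2|) ∧
    ¬ BddAbove S ∧ ¬ BddBelow S ∧
    ∀ Λ : ℝ, ¬ AccPt Λ (Filter.principal S) := by
  have hσ : 0 < sigmaF α := by
    rw [hpq]
    have hp0 : (0:ℝ) < p := by exact_mod_cast hp
    have hq0 : (0:ℝ) < q := by exact_mod_cast hq
    positivity
  have hc := main_c Z hα hp hq hpq h4
  refine ⟨hc, ?_, ?_, ?_⟩
  · rintro ⟨B, hB⟩
    obtain ⟨h, H, -, -⟩ := good_all Z 0
    obtain ⟨k, hk, hk1⟩ := (((IsZeros.tendsto H (Z 0)).eventually_gt_atTop (max B 1)).and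
      (eventually_ge_atTop 1)).exists
    have hk0 : (1:ℝ) ≤ k := by exact_mod_cast hk1
    have hmem : (a 0 k)^2 ∈ S := by
      rw [hS]
      refine ⟨0, k, hk1, ?_, by simp⟩
      simp only [Nat.cast_zero]
      nlinarith
    have := hB hmem
    have h1 := (le_max_left B 1).trans_lt hk
    have h2 := (le_max_right B 1).trans_lt hk
    nlinarith
  · rintro ⟨B, hB⟩
    obtain ⟨γ, g1, g2, N, hN⟩ := first_zero Z hα
    have hg : 0 < α^2 - γ^2 := by nlinarith
    obtain ⟨N1, hN1⟩ := exists_nat_gt (|B| / (α^2 - γ^2))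
    obtain ⟨N2, hN2⟩ := exists_nat_gt (sigmaF α)
    set n := max (max N 1) (max N1 N2) with hn
    have n1 : N ≤ n := (le_max_left _ _).trans (le_max_left _ _)
    have n2 : (1:ℝ) ≤ n := by exact_mod_cast (le_max_right N 1).trans (le_max_left _ _)
    have n3 : (N1:ℝ) ≤ n := by exact_mod_cast (le_max_left N1 N2).trans (le_max_right _ _)
    have n4 : (N2:ℝ) ≤ n := by exact_mod_cast (le_max_right N1 N2).trans (le_max_right _ _)
    have hmem : (a n 1)^2 - α^2*(n:ℝ)^2 ∈ S := by
      rw [hS]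
      refine ⟨n, 1, le_rfl, ?_, rfl⟩
      have : sigmaF α * ((1:ℕ):ℝ) - sigmaF α / 4 < n := by push_cast; linarith
      exact this.ne'
    have h1 := hB hmem
    have h2 := hN n n1
    have h3 := (Z n).pos 1 le_rfl
    have h5 : (a n 1)^2 ≤ (γ * n)^2 := by gcongr
    rw [div_lt_iff₀ hg] at hN1
    have h6 : |B| < n * (α^2 - γ^2) := by nlinarith
    have h7 : (n:ℝ) * (α^2 - γ^2) ≤ (n:ℝ)^2 * (α^2 - γ^2) := by
      apply mul_le_mul_of_nonneg_right _ hg.le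
      nlinarith
    have h8 := neg_abs_le B
    nlinarith
  · intro Λ hacc
    obtain ⟨c, hc0, hcb⟩ := hc
    set R := (|Λ| + 1) / c with hR
    obtain ⟨N, hN⟩ := exists_nat_gt (R^2 + (|Λ| + 1))
    have hfin := (fin_pairs Z N R).image (fun x : ℕ × ℕ => (a x.1 x.2)^2 - α^2*(x.1:ℝ)^2)
    have hfin2 := hfin.insert 0
    have hsub : S ∩ Ioo (Λ-1) (Λ+1) ⊆ insert 0 ((fun x : ℕ × ℕ => (a x.1 x.2)^2 - α^2*(x.1:ℝ)^2) ''
        {x : ℕ × ℕ | x.1 < N ∧ a x.1 x.2 ≤ R}) := by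
      rintro y ⟨hy, hy1, hy2⟩
      rw [hS] at hy
      obtain ⟨n, k, hk, hne, hyy⟩ := hy
      rcases hcb n k hk hne with h0 | h1
      · left; rw [hyy, h0]
      · right
        rw [← hyy] at h1
        have hyabs : |y| ≤ |Λ| + 1 := by
          have l1 := neg_abs_le Λ
          have l2 := le_abs_self Λ
          rw [abs_le]; constructor <;> linarith
        have haR : a n k ≤ R := by
          rw [hR, le_div_iff₀ hc0]; linarith
        have hpos := (Z n).pos k hk
        refine ⟨(n, k), ⟨?_, haR⟩, hyy.symm⟩
        have h2 : (a n k)^2 ≤ R^2 := by gcongr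
        have h3 := (abs_le.1 hyabs).1
        have h4 : α^2 * (n:ℝ)^2 ≤ R^2 + (|Λ| + 1) := by linarith
        have h5 : (n:ℝ)^2 ≤ α^2 * (n:ℝ)^2 := by
          have : 1 ≤ α^2 := by nlinarith
          nlinarith [sq_nonneg (n:ℝ)]
        have h6 : (n:ℝ) ≤ (n:ℝ)^2 := by exact_mod_cast Nat.le_self_pow (by norm_num) n
        have h7 : (n:ℝ) < N := by linarith
        exact_mod_cast h7
    have hF := hfin2.subset hsub
    rw [accPt_iff_nhds] at hacc
    have hU : Ioo (Λ-1) (Λ+1) \ ((S ∩ Ioo (Λ-1) (Λ+1)) \ {Λ}) ∈ 𝓝 Λ := by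
      refine inter_mem (Ioo_mem_nhds (by linarith) (by linarith)) ?_
      refine (hF.subset sdiff_subset).isClosed.isOpen_compl.mem_nhds ?_
      simp
    obtain ⟨y, ⟨hy1, hy2⟩, hy3⟩ := hacc _ hU
    exact hy1.2 ⟨⟨hy2, hy1.1⟩, hy3⟩
end

theorem stmt_16 (α : ℝ) (hα : 1 < α)
    (p q : ℕ) (hp : 0 < p) (hq : 0 < q) (hcop : Nat.Coprime p q)
    (hpq : sigmaF α = (p:ℝ)/q)
    (hcond : 4 ∣ p ∧ Odd q)
    (J : ℝ → ℕ → ℝ)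
    (hJpos : ∀ ν : ℝ, 0 ≤ ν → ∀ k : ℕ, 1 ≤ k → 0 < J ν k)
    (hJmono : ∀ ν : ℝ, 0 ≤ ν → ∀ k l : ℕ, 1 ≤ k → k < l → J ν k < J ν l)
    (hJzero : ∀ ν : ℝ, 0 ≤ ν → ∀ k : ℕ, 1 ≤ k → besselJ ν (J ν k) = 0)
    (hJall : ∀ ν : ℝ, 0 ≤ ν → ∀ z : ℝ, 0 < z → besselJ ν z = 0 →
      ∃ k : ℕ, 1 ≤ k ∧ J ν k = z)
    (S : Set ℝ)
    (hS : S = {y : ℝ | ∃ ℓ k : ℕ, 1 ≤ k ∧ (ℓ:ℝ) ≠ sigmaF α * k - sigmaF α / 4 ∧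
      y = (J ℓ k)^2 - α^2*(ℓ:ℝ)^2}) :
    (∃ c : ℝ, 0 < c ∧ ∀ ℓ : ℕ, ∀ k : ℕ, 1 ≤ k →
        (ℓ:ℝ) ≠ sigmaF α * k - sigmaF α / 4 →
        (J ℓ k)^2 - α^2*(ℓ:ℝ)^2 = 0 ∨
        c * J ℓ k ≤ |(J ℓ k)^2 - α^2*(ℓ:ℝ)^2|) ∧
    ¬ BddAbove S ∧ ¬ BddBelow S ∧
    ∀ Λ : ℝ, ¬ AccPt Λ (Filter.principal S) := by
  have Z : ∀ n : ℕ, IsZeros n (fun k => J (n:ℝ) k) := by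
    intro n
    have hn : (0:ℝ) ≤ n := Nat.cast_nonneg n
    refine ⟨hJpos n hn, hJmono n hn, fun k hk => ?_, fun z hz h0 => ?_⟩
    · rw [← besselJ_eq_jb]; exact hJzero n hn k hk
    · exact hJall n hn z hz (by rw [besselJ_eq_jb]; exact h0)
  exact main_all Z hα hp hq hpq hcond.1 S hS
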